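/- Let p₁(·), p₂(·) : ℝⁿ → [1,∞) be measurable exponent functions with pⱼ(·) ∈ LH for j = 1,2, define p(·) by 1/p(x) = 1/p₁(x) + 1/p₂(x), and let w₁, w₂ be weights with w = w₁w₂. Then (w₁,w₂,w) ∈ A_{p⃗(·)} if and only if there is a constant C such that for every family 𝒬 of pairwise disjoint cubes, ‖T_𝒬(f₁,f₂)w‖_{p(·)} ≤ C‖f₁w₁‖_{p₁(·)}‖f₂w₂‖_{p₂(·)} for all f₁, f₂, where T_𝒬(f₁,f₂)(x) = Σ_{Q∈𝒬}(⨍_Q f₁ dy)(⨍_Q f₂ dy)χ_Q(x). -/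

import Mathlib

open MeasureTheory ENNReal Set

noncomputable section

/-- Euclidean space `ℝⁿ`. -/
abbrev Rn (n : ℕ) : Type := Fin n → ℝ

/-- A cube in `ℝⁿ` with sides parallel to the coordinate axes. -/
structure Cube (n : ℕ) : Type where
  base : Fin n → ℝ
  side : ℝ
  side_pos : 0 < side

namespace Cube

/-- The set of points of a cube. -/
def toSet {n : ℕ} (Q : Cube n) : Set (Rn n) :=
  {x | ∀ i, Q.base i ≤ x i ∧ x i < Q.base i + Q.side}

/-- The volume `|Q|` of a cube. -/
def vol {n : ℕ} (Q : Cube n) : ℝ≥0∞ := ENNReal.ofReal (Q.side ^ n)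

/-- Membership in the standard dyadic grid `𝒟₀`. -/
def IsDyadic {n : ℕ} (Q : Cube n) : Prop :=
  ∃ (k : ℤ) (j : Fin n → ℤ), Q.side = (2 : ℝ) ^ (-k) ∧
    ∀ i, Q.base i = (2 : ℝ) ^ (-k) * (j i : ℝ)

end Cube

/-- The modular associated to an extended-real-valued exponent `r(·)`:
`ρ(f/λ) = ∫_{r ≠ ∞} (f/λ)^{r(x)} dμ + ‖f/λ‖_{L^∞({r = ∞})}`. -/
def eModular {n : ℕ} (r : Rn n → ℝ≥0∞) (μ : Measure (Rn n)) (f : Rn n → ℝ≥0∞)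
    (lam : ℝ≥0∞) : ℝ≥0∞ :=
  (∫⁻ x in {x | r x ≠ ∞}, (f x / lam) ^ (r x).toReal ∂μ)
    + essSup (fun x => f x / lam) (μ.restrict {x | r x = ∞})

/-- The variable Lebesgue (quasi)norm `‖f‖_{r(·)}` with respect to a measure `μ`. -/
def eNorm {n : ℕ} (r : Rn n → ℝ≥0∞) (μ : Measure (Rn n)) (f : Rn n → ℝ≥0∞) : ℝ≥0∞ :=
  sInf {lam : ℝ≥0∞ | lam ≠ 0 ∧ eModular r μ f lam ≤ 1}

/-- The variable Lebesgue norm of a real-valued function with respect to Lebesgue measure. -/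
def vNorm {n : ℕ} (r : Rn n → ℝ≥0∞) (f : Rn n → ℝ) : ℝ≥0∞ :=
  eNorm r volume fun x => ENNReal.ofReal |f x|

/-- View a real-valued exponent as an extended-real-valued one. -/
def ofExp {n : ℕ} (p : Rn n → ℝ) : Rn n → ℝ≥0∞ := fun x => ENNReal.ofReal (p x)

/-- The conjugate of an extended real exponent: `1/t + 1/t' = 1`. -/
def econj (t : ℝ≥0∞) : ℝ≥0∞ :=
  if t = 1 then ∞ else if t = ∞ then 1 else ENNReal.ofReal (t.toReal / (t.toReal - 1))

/-- The pointwise conjugate exponent `p'(·)` of a real-valued exponent. -/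
def conjExp {n : ℕ} (p : Rn n → ℝ) : Rn n → ℝ≥0∞ := fun x => econj (ENNReal.ofReal (p x))

/-- A weight: a measurable function that is positive (and finite) a.e. -/
def IsWeight {n : ℕ} (w : Rn n → ℝ) : Prop :=
  Measurable w ∧ ∀ᵐ x ∂(volume : Measure (Rn n)), 0 < w x

/-- Local log-Hölder continuity `LH₀`. -/
def LH0 {n : ℕ} (p : Rn n → ℝ) : Prop :=
  ∃ C₀ > 0, ∀ x y : Rn n, dist x y < 1 / 2 →
    |1 / p x - 1 / p y| ≤ C₀ / (-Real.log (dist x y))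

/-- Log-Hölder continuity at infinity with a given asymptotic value `pinf`. -/
def LHinfWith {n : ℕ} (p : Rn n → ℝ) (pinf : ℝ) : Prop :=
  ∃ C > 0, ∀ x : Rn n, |1 / p x - 1 / pinf| ≤ C / Real.log (Real.exp 1 + ‖x‖)

/-- Log-Hölder continuity at infinity `LH∞`. -/
def LHinf {n : ℕ} (p : Rn n → ℝ) : Prop := ∃ pinf > 0, LHinfWith p pinf

/-- Log-Hölder continuity `LH = LH₀ ∩ LH∞`. -/
def LH {n : ℕ} (p : Rn n → ℝ) : Prop := LH0 p ∧ LHinf p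

/-- The bilinear variable Muckenhoupt condition `(w₁,w₂,w) ∈ A_{p⃗(·)}`. -/
def ApVec {n : ℕ} (p₁ p₂ p w₁ w₂ w : Rn n → ℝ) : Prop :=
  ∃ C : ℝ≥0∞, C ≠ ∞ ∧ ∀ Q : Cube n,
    Q.vol⁻¹ ^ 2 * vNorm (ofExp p) (Q.toSet.indicator w) *
      vNorm (conjExp p₁) (Q.toSet.indicator fun x => (w₁ x)⁻¹) *
      vNorm (conjExp p₂) (Q.toSet.indicator fun x => (w₂ x)⁻¹) ≤ C

/-- The variable Muckenhoupt class `A_{r(·)}` for an extended-real-valued exponent. -/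
def ApVarE {n : ℕ} (r : Rn n → ℝ≥0∞) (v : Rn n → ℝ) : Prop :=
  ∃ C : ℝ≥0∞, C ≠ ∞ ∧ ∀ Q : Cube n,
    Q.vol⁻¹ * vNorm r (Q.toSet.indicator v) *
      vNorm (fun x => econj (r x)) (Q.toSet.indicator fun x => (v x)⁻¹) ≤ C

/-- The bilinear maximal operator `M(f₁,f₂)`. -/
def biMax {n : ℕ} (f₁ f₂ : Rn n → ℝ) (x : Rn n) : ℝ≥0∞ :=
  ⨆ (Q : Cube n) (_ : x ∈ Q.toSet),
    (Q.vol⁻¹ * ∫⁻ y in Q.toSet, ENNReal.ofReal |f₁ y|) *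
      (Q.vol⁻¹ * ∫⁻ y in Q.toSet, ENNReal.ofReal |f₂ y|)

/-- The dyadic bilinear maximal operator `M^d(f₁,f₂)`. -/
def biMaxD {n : ℕ} (f₁ f₂ : Rn n → ℝ) (x : Rn n) : ℝ≥0∞ :=
  ⨆ (Q : Cube n) (_ : Q.IsDyadic) (_ : x ∈ Q.toSet),
    (Q.vol⁻¹ * ∫⁻ y in Q.toSet, ENNReal.ofReal |f₁ y|) *
      (Q.vol⁻¹ * ∫⁻ y in Q.toSet, ENNReal.ofReal |f₂ y|)

/-- The bilinear averaging operator `A_Q(f₁,f₂) = (⨍_Q f₁)(⨍_Q f₂)χ_Q`. -/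
def avgOp {n : ℕ} (Q : Cube n) (f₁ f₂ : Rn n → ℝ) (x : Rn n) : ℝ≥0∞ :=
  Q.toSet.indicator
    (fun _ =>
      (Q.vol⁻¹ * ∫⁻ y in Q.toSet, ENNReal.ofReal |f₁ y|) *
        (Q.vol⁻¹ * ∫⁻ y in Q.toSet, ENNReal.ofReal |f₂ y|)) x

/-- `(p)₋(Q)`, the essential infimum of `p` on a cube `Q`. -/
def pMinusOn {n : ℕ} (p : Rn n → ℝ) (Q : Cube n) : ℝ :=
  essInf p (volume.restrict Q.toSet)

/-- The exponent `q(Q)` with `1/q(Q) = 1/(p₁)₋(Q) + 1/(p₂)₋(Q)`. -/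
def qExp {n : ℕ} (p₁ p₂ : Rn n → ℝ) (Q : Cube n) : ℝ :=
  ((pMinusOn p₁ Q)⁻¹ + (pMinusOn p₂ Q)⁻¹)⁻¹

/-- The bilinear averaging operator `T_𝒬` over a disjoint family of cubes. -/
def TQ {n : ℕ} (𝒬 : Set (Cube n)) (f₁ f₂ : Rn n → ℝ) (x : Rn n) : ℝ≥0∞ :=
  ∑' Q : 𝒬, avgOp (Q : Cube n) f₁ f₂ x

section VariableNorm

variable {n : ℕ}

lemma eModular_mono {r : Rn n → ℝ≥0∞} {μ : Measure (Rn n)} {f g : Rn n → ℝ≥0∞}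
    {a b : ℝ≥0∞} (hfg : ∀ x, f x ≤ g x) (hba : b ≤ a) :
    eModular r μ f a ≤ eModular r μ g b := by
  unfold eModular
  refine add_le_add ?_ ?_
  · exact lintegral_mono fun x =>
      ENNReal.rpow_le_rpow (ENNReal.div_le_div (hfg x) hba) ENNReal.toReal_nonneg
  · exact essSup_mono_ae (Filter.Eventually.of_forall fun x => ENNReal.div_le_div (hfg x) hba)

lemma eNorm_le {r : Rn n → ℝ≥0∞} {μ : Measure (Rn n)} {f : Rn n → ℝ≥0∞} {a : ℝ≥0∞}
    (ha : a ≠ 0) (h : eModular r μ f a ≤ 1) : eNorm r μ f ≤ a :=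
  sInf_le ⟨ha, h⟩

lemma eModular_le_one_of_eNorm_lt {r : Rn n → ℝ≥0∞} {μ : Measure (Rn n)} {f : Rn n → ℝ≥0∞}
    {a : ℝ≥0∞} (h : eNorm r μ f < a) : eModular r μ f a ≤ 1 := by
  obtain ⟨b, ⟨-, hb⟩, hba⟩ := sInf_lt_iff.1 h
  exact (eModular_mono (fun _ => le_rfl) hba.le).trans hb

lemma one_lt_eModular_of_lt_eNorm {r : Rn n → ℝ≥0∞} {μ : Measure (Rn n)} {f : Rn n → ℝ≥0∞}
    {a : ℝ≥0∞} (ha : a ≠ 0) (h : a < eNorm r μ f) : 1 < eModular r μ f a := by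
  by_contra! h'
  exact (eNorm_le ha h').not_gt h

lemma eNorm_mono {r : Rn n → ℝ≥0∞} {μ : Measure (Rn n)} {f g : Rn n → ℝ≥0∞}
    (hfg : ∀ x, f x ≤ g x) : eNorm r μ f ≤ eNorm r μ g :=
  sInf_le_sInf fun _ ⟨h0, h⟩ => ⟨h0, (eModular_mono hfg le_rfl).trans h⟩

lemma eNorm_congr_ae {r : Rn n → ℝ≥0∞} {μ : Measure (Rn n)} {f g : Rn n → ℝ≥0∞}
    (hfg : f =ᵐ[μ] g) : eNorm r μ f = eNorm r μ g := by
  have key : ∀ a, eModular r μ f a = eModular r μ g a := by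
    intro a
    unfold eModular
    congr 1
    · refine lintegral_congr_ae (ae_restrict_of_ae ?_)
      filter_upwards [hfg] with x hx
      rw [hx]
    · refine essSup_congr_ae (ae_restrict_of_ae ?_)
      filter_upwards [hfg] with x hx
      rw [hx]
  simp only [eNorm, key]

lemma eModular_ofExp {p : Rn n → ℝ} (hp : ∀ x, 0 ≤ p x) (μ : Measure (Rn n))
    (f : Rn n → ℝ≥0∞) (a : ℝ≥0∞) :
    eModular (ofExp p) μ f a = ∫⁻ x, (f x / a) ^ p x ∂μ := by
  have h1 : {x | ofExp p x ≠ ∞} = univ := by ext; simp [ofExp]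
  have h2 : {x | ofExp p x = ∞} = ∅ := by ext; simp [ofExp]
  rw [eModular, h1, h2]
  simp [ofExp, ENNReal.toReal_ofReal (hp _)]

lemma mul_eNorm_le_eNorm_const_mul (r : Rn n → ℝ≥0∞) (μ : Measure (Rn n))
    (f : Rn n → ℝ≥0∞) (c : ℝ≥0∞) :
    c * eNorm r μ f ≤ eNorm r μ fun x => c * f x := by
  have key : ∀ c : ℝ≥0∞, c ≠ ∞ → c * eNorm r μ f ≤ eNorm r μ fun x => c * f x := by
    intro c hc
    rcases eq_or_ne c 0 with rfl | hc0
    · simp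
    refine le_sInf ?_
    rintro a ⟨ha0, ha⟩
    have : eNorm r μ f ≤ a / c := by
      refine eNorm_le (ENNReal.div_pos ha0 hc).ne' (le_trans (le_of_eq ?_) ha)
      have : ∀ x, f x / (a / c) = c * f x / a := fun x => by
        rw [div_eq_mul_inv, ENNReal.inv_div (Or.inl hc) (Or.inl hc0), ← mul_div_assoc, mul_comm]
      simp only [eModular, this]
    calc c * eNorm r μ f ≤ c * (a / c) := by gcongr
      _ = a := ENNReal.mul_div_cancel hc0 hc
  rcases ne_or_eq c ∞ with hc | rfl
  · exact key c hc
  refine ENNReal.mul_le_of_forall_lt fun a ha b hb => ?_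
  calc a * b ≤ a * eNorm r μ f := by gcongr
    _ ≤ _ := key a ha.ne
    _ ≤ _ := eNorm_mono fun x => by gcongr

/-- A function of vanishing variable Lebesgue norm vanishes almost everywhere. -/
lemma ae_eq_zero_of_eNorm_eq_zero {r : Rn n → ℝ≥0∞} {μ : Measure (Rn n)} {f : Rn n → ℝ≥0∞}
    (hr : Measurable r) (hr2 : ∀ x, 2⁻¹ ≤ r x) (hf : Measurable f) (h : eNorm r μ f = 0) :
    f =ᵐ[μ] 0 := by
  have hmod : ∀ a : ℝ≥0∞, 0 < a → eModular r μ f a ≤ 1 := fun a ha =>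
    eModular_le_one_of_eNorm_lt (h ▸ ha)
  have hmeas : MeasurableSet {x | r x = ∞} := hr (measurableSet_singleton ∞)
  have htop : ∀ᵐ x ∂(μ.restrict {x | r x = ∞}), f x = 0 := by
    have : ∀ k : ℕ, ∀ᵐ x ∂(μ.restrict {x | r x = ∞}), f x ≤ ((k : ℝ≥0∞) + 1)⁻¹ := by
      intro k
      have hk : 0 < ((k : ℝ≥0∞) + 1)⁻¹ := ENNReal.inv_pos.2 (by simp)
      have h1 := le_add_self.trans (hmod _ hk)
      filter_upwards [ENNReal.ae_le_essSup (μ := μ.restrict {x | r x = ∞})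
        (fun x => f x / ((k : ℝ≥0∞) + 1)⁻¹)] with x hx
      have h2 := hx.trans h1
      rwa [ENNReal.div_le_iff hk.ne' (by simp), one_mul] at h2
    filter_upwards [ae_all_iff.2 this] with x hx
    by_contra h0
    obtain ⟨k, hk⟩ := ENNReal.exists_inv_nat_lt h0
    refine (hk.trans_le (hx k)).not_ge ?_
    gcongr
    exact le_self_add
  have hfin : ∀ᵐ x ∂(μ.restrict {x | r x ≠ ∞}), f x = 0 := by
    set I := ∫⁻ x in {x | r x ≠ ∞}, f x ^ (r x).toReal ∂μ with hI
    have hbound : ∀ k : ℕ, ((k : ℝ≥0∞) + 1) * I ≤ 1 := by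
      intro k
      have hk : 0 < (((k : ℝ≥0∞) + 1) ^ 2)⁻¹ := ENNReal.inv_pos.2 (by finiteness)
      refine le_trans ?_ (le_self_add.trans (hmod _ hk))
      rw [hI, ← lintegral_const_mul' _ _ (by finiteness)]
      refine setLIntegral_mono' (hmeas.compl) fun x hx => ?_
      rw [div_eq_mul_inv, inv_inv, mul_comm (f x),
        ENNReal.mul_rpow_of_nonneg _ _ ENNReal.toReal_nonneg]
      gcongr
      have h3 : (2 : ℝ)⁻¹ ≤ (r x).toReal := by
        have := ENNReal.toReal_mono hx (hr2 x)
        simpa using this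
      calc ((k : ℝ≥0∞) + 1) = (((k : ℝ≥0∞) + 1) ^ 2) ^ (2⁻¹ : ℝ) := by
            rw [← ENNReal.rpow_natCast, ← ENNReal.rpow_mul]; norm_num
        _ ≤ _ := ENNReal.rpow_le_rpow_of_exponent_le (one_le_pow₀ (by simp)) h3
    have hI0 : I = 0 := by
      by_contra h0
      obtain ⟨k, hk⟩ := ENNReal.exists_nat_mul_gt h0 ENNReal.one_ne_top
      exact (hk.trans_le ((mul_le_mul_left (le_self_add) I).trans (hbound k))).false
    rw [hI, lintegral_eq_zero_iff (by fun_prop)] at hI0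
    filter_upwards [hI0] with x hx
    have := ENNReal.rpow_eq_zero_iff.1 hx
    rcases this with h | h
    · exact h.1
    · exact absurd h.2 (by simp)
  rw [← Measure.restrict_add_restrict_compl (μ := μ) hmeas]
  exact ae_add_measure_iff.2 ⟨htop, hfin⟩

end VariableNorm

section Duality

open scoped NNReal

variable {n : ℕ} {p : Rn n → ℝ}

lemma conjExp_of_eq_one {x : Rn n} (h : p x = 1) : conjExp p x = ∞ := by
  simp [conjExp, econj, h]

lemma conjExp_of_one_lt {x : Rn n} (h : 1 < p x) :
    conjExp p x = ENNReal.ofReal (Real.conjExponent (p x)) := by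
  have h1 : ENNReal.ofReal (p x) ≠ 1 := by
    rw [Ne, ENNReal.ofReal_eq_one]; exact h.ne'
  simp [conjExp, econj, h1, Real.conjExponent, ENNReal.toReal_ofReal (zero_le_one.trans h.le)]

lemma conjExp_eq_top_iff (hp1 : ∀ x, 1 ≤ p x) {x : Rn n} : conjExp p x = ∞ ↔ p x = 1 := by
  refine ⟨fun h => ?_, conjExp_of_eq_one⟩
  by_contra hne
  rw [conjExp_of_one_lt ((hp1 x).lt_of_ne' hne)] at h
  exact ENNReal.ofReal_ne_top h

lemma conjExp_toReal {x : Rn n} (h : 1 < p x) :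
    (conjExp p x).toReal = Real.conjExponent (p x) := by
  rw [conjExp_of_one_lt h,
    ENNReal.toReal_ofReal (Real.HolderConjugate.conjExponent h).symm.nonneg]

lemma one_le_conjExp (hp1 : ∀ x, 1 ≤ p x) (x : Rn n) : 1 ≤ conjExp p x := by
  rcases (hp1 x).eq_or_lt with h | h
  · simp [conjExp_of_eq_one h.symm]
  · rw [conjExp_of_one_lt h, ENNReal.one_le_ofReal]
    exact (Real.HolderConjugate.conjExponent h).symm.lt.le

lemma measurable_conjExp (hp : Measurable p) (hp1 : ∀ x, 1 ≤ p x) : Measurable (conjExp p) := by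
  have : conjExp p = fun x => if p x = 1 then ∞ else ENNReal.ofReal (p x / (p x - 1)) := by
    ext x
    split_ifs with h
    · exact conjExp_of_eq_one h
    · exact conjExp_of_one_lt ((hp1 x).lt_of_ne' h)
  rw [this]
  exact Measurable.ite (hp (measurableSet_singleton 1)) measurable_const (by fun_prop)

/-- Hölder's inequality in variable Lebesgue spaces. -/
lemma lintegral_mul_le_of_eModular_le_one (hp : Measurable p) (hp1 : ∀ x, 1 ≤ p x)
    {f g : Rn n → ℝ≥0∞} (hf : Measurable f) {a b : ℝ≥0∞} (ha0 : a ≠ 0) (ha : a ≠ ∞)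
    (hb0 : b ≠ 0) (hb : b ≠ ∞) (hfa : eModular (ofExp p) volume f a ≤ 1)
    (hgb : eModular (conjExp p) volume g b ≤ 1) :
    ∫⁻ x, f x * g x ≤ 2 * (a * b) := by
  have hmeas : MeasurableSet {x | conjExp p x ≠ ∞} :=
    (measurable_conjExp hp hp1 (measurableSet_singleton ∞)).compl
  have hmeas' : MeasurableSet {x | conjExp p x = ∞} :=
    (measurable_conjExp hp hp1 (measurableSet_singleton ∞))
  rw [eModular_ofExp (fun x => zero_le_one.trans (hp1 x))] at hfa
  have hsup : ∀ᵐ x ∂volume, x ∈ {x | conjExp p x = ∞} → g x / b ≤ 1 := by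
    rw [← ae_restrict_iff' hmeas']
    filter_upwards [ENNReal.ae_le_essSup (μ := volume.restrict {x | conjExp p x = ∞})
      (fun x => g x / b)] with x hx
    exact hx.trans (le_add_self.trans hgb)
  have hpt : ∀ᵐ x ∂volume, f x * g x ≤ a * b * ((f x / a) ^ p x +
      {x | conjExp p x ≠ ∞}.indicator (fun x => (g x / b) ^ (conjExp p x).toReal) x) := by
    filter_upwards [hsup] with x hx
    have hfg : f x * g x = a * b * (f x / a * (g x / b)) := by
      rw [mul_mul_mul_comm, ENNReal.mul_div_cancel ha0 ha, ENNReal.mul_div_cancel hb0 hb]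
    rw [hfg]
    gcongr
    rcases (hp1 x).eq_or_lt with h | h
    · rw [← h, ENNReal.rpow_one]
      refine le_add_right (mul_le_of_le_one_right' (hx (conjExp_of_eq_one h.symm)))
    · have hne : x ∈ {x | conjExp p x ≠ ∞} := fun h' => h.ne' ((conjExp_eq_top_iff hp1).1 h')
      rw [indicator_of_mem hne, conjExp_toReal h]
      have hc := Real.HolderConjugate.conjExponent h
      refine (ENNReal.young_inequality _ _ hc).trans (add_le_add ?_ ?_)
      · exact ENNReal.div_le_of_le_mul (le_mul_of_one_le_right' (by simpa using h.le))
      · exact ENNReal.div_le_of_le_mul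
          (le_mul_of_one_le_right' (by simpa using hc.symm.lt.le))
  calc ∫⁻ x, f x * g x ≤ ∫⁻ x, a * b * ((f x / a) ^ p x +
      {x | conjExp p x ≠ ∞}.indicator (fun x => (g x / b) ^ (conjExp p x).toReal) x) :=
        lintegral_mono_ae hpt
    _ = a * b * ((∫⁻ x, (f x / a) ^ p x) +
          ∫⁻ x in {x | conjExp p x ≠ ∞}, (g x / b) ^ (conjExp p x).toReal) := by
        rw [lintegral_const_mul' _ _ (ENNReal.mul_ne_top ha hb),
          lintegral_add_left (by fun_prop), lintegral_indicator hmeas]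
    _ ≤ a * b * (1 + 1) := by
        gcongr
        exact le_self_add.trans hgb
    _ = 2 * (a * b) := by rw [one_add_one_eq_two, mul_comm]

/-- The norm with exponent `p'` is attained, up to a factor, by duality with `L^{p(·)}`. -/
lemma exists_dual_of_lt_eNorm (hp : Measurable p) (hp1 : ∀ x, 1 ≤ p x) {v : Rn n → ℝ≥0}
    (hv : Measurable v) {t : ℝ≥0∞} (ht : t < eNorm (conjExp p) volume fun x => (v x : ℝ≥0∞)) :
    ∃ h : Rn n → ℝ≥0, Measurable h ∧ ∫⁻ x, (h x : ℝ≥0∞) ^ p x ≤ 1 ∧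
      t ≤ 2 * ∫⁻ x, (h x : ℝ≥0∞) * v x := by
  have hp0 : ∀ x, 0 < p x := fun x => one_pos.trans_le (hp1 x)
  rcases eq_or_ne t 0 with rfl | ht0
  · refine ⟨0, measurable_const, ?_, zero_le⟩
    simp [ENNReal.zero_rpow_of_pos (hp0 _)]
  have hmod := one_lt_eModular_of_lt_eNorm ht0 ht
  lift t to ℝ≥0 using ht.ne_top
  have ht0' : t ≠ 0 := by exact_mod_cast ht0
  have hmeas : MeasurableSet {x | conjExp p x ≠ ∞} :=
    (measurable_conjExp hp hp1 (measurableSet_singleton ∞)).compl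
  have hmeas1 : MeasurableSet {x | p x = 1} := hp (measurableSet_singleton 1)
  unfold eModular at hmod
  by_cases hI : 2⁻¹ < ∫⁻ x in {x | conjExp p x ≠ ∞}, ((v x : ℝ≥0∞) / t) ^ (conjExp p x).toReal
  · have hI' : 2⁻¹ < ∫⁻ x, ((if p x = 1 then 0 else (v x / t) ^ (Real.conjExponent (p x)) : ℝ≥0)
        : ℝ≥0∞) := by
      refine hI.trans_eq ?_
      rw [← lintegral_indicator hmeas]
      refine lintegral_congr fun x => ?_
      by_cases hx : p x = 1
      · rw [if_pos hx, indicator_of_notMem (not_not_intro (conjExp_of_eq_one hx)),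
          ENNReal.coe_zero]
      · have h1 := (hp1 x).lt_of_ne' hx
        have hne : x ∈ {x | conjExp p x ≠ ∞} := fun h => hx ((conjExp_eq_top_iff hp1).1 h)
        rw [if_neg hx, indicator_of_mem hne,
          conjExp_toReal h1, ENNReal.coe_rpow_of_nonneg _
            (Real.HolderConjugate.conjExponent h1).symm.nonneg, ENNReal.coe_div ht0']
    obtain ⟨g, hgF, hgtop, hg⟩ := exists_lt_lintegral_simpleFunc_of_lt_lintegral hI'
    obtain ⟨J, hJ⟩ : ∃ J : ℝ≥0, ∫⁻ x, (g x : ℝ≥0∞) = J := ⟨_, (ENNReal.coe_toNNReal hgtop.ne).symm⟩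
    rw [hJ] at hg
    have hJ2 : 2⁻¹ < J := by
      rw [← ENNReal.coe_lt_coe]; simpa using hg
    have hgm : Measurable g := g.measurable
    set κ : ℝ≥0 := (max 1 J)⁻¹ with hκ
    have hκ1 : κ ≤ 1 := inv_le_one_of_one_le₀ (le_max_left _ _)
    refine ⟨fun x => κ * g x ^ (1 / p x), by fun_prop, ?_, ?_⟩
    · calc ∫⁻ x, ((κ * g x ^ (1 / p x) : ℝ≥0) : ℝ≥0∞) ^ p x ≤ ∫⁻ x, (κ : ℝ≥0∞) * g x := by
            refine lintegral_mono fun x => ?_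
            simp only
            rw [← ENNReal.coe_rpow_of_nonneg _ (hp0 x).le, ← ENNReal.coe_mul,
              ENNReal.coe_le_coe, NNReal.mul_rpow, ← NNReal.rpow_mul,
              one_div_mul_cancel (hp0 x).ne', NNReal.rpow_one]
            gcongr
            exact NNReal.rpow_le_self_of_le_one hκ1 (hp1 x)
        _ = κ * J := by rw [lintegral_const_mul' _ _ ENNReal.coe_ne_top, hJ]
        _ ≤ 1 := by
            rw [← ENNReal.coe_mul, ← ENNReal.coe_one, ENNReal.coe_le_coe, hκ]
            exact inv_mul_le_one_of_le₀ (le_max_right _ _) zero_le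
    · have hlow : (t : ℝ≥0∞) * (κ * J) ≤ ∫⁻ x, ((κ * g x ^ (1 / p x) : ℝ≥0) : ℝ≥0∞) * v x := by
        rw [← hJ, ← lintegral_const_mul' _ _ ENNReal.coe_ne_top,
          ← lintegral_const_mul' _ _ ENNReal.coe_ne_top]
        refine lintegral_mono fun x => ?_
        simp only
        rw [← ENNReal.coe_mul, ← ENNReal.coe_mul, ← ENNReal.coe_mul, ENNReal.coe_le_coe]
        have hgx := hgF x
        by_cases hx : p x = 1
        · rw [if_pos hx] at hgx
          rw [le_zero_iff.1 hgx]; simp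
        rw [if_neg hx] at hgx
        have hc := Real.HolderConjugate.conjExponent ((hp1 x).lt_of_ne' hx)
        have h1 : g x ^ (1 / Real.conjExponent (p x)) ≤ v x / t := by
          rw [one_div, NNReal.rpow_inv_le_iff hc.symm.pos]
          exact hgx
        have h2 : t * g x ^ (1 / Real.conjExponent (p x)) ≤ v x := by
          rw [mul_comm]; exact (le_div_iff₀ (pos_iff_ne_zero.2 ht0')).1 h1
        have h3 : g x ^ (1 / p x) * g x ^ (1 / Real.conjExponent (p x)) = g x := by
          rw [← NNReal.rpow_add_of_nonneg _ (one_div_nonneg.2 (hp0 x).le)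
            (one_div_nonneg.2 hc.symm.nonneg), one_div, one_div, hc.inv_add_inv_eq_one,
            NNReal.rpow_one]
        calc t * (κ * g x)
            = κ * g x ^ (1 / p x) * (t * g x ^ (1 / Real.conjExponent (p x))) := by
              conv_lhs => rw [← h3]
              ring
          _ ≤ _ := by gcongr
      have h2 : (1 : ℝ≥0) ≤ 2 * (κ * J) := by
        have hm : (0 : ℝ≥0) < max 1 J := zero_lt_one.trans_le (le_max_left _ _)
        rw [hκ, mul_left_comm, ← div_eq_inv_mul, one_le_div hm]
        refine max_le ?_ (le_mul_of_one_le_left' one_le_two)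
        rw [inv_lt_iff_one_lt_mul₀ two_pos] at hJ2
        rw [mul_comm]
        exact hJ2.le
      calc (t : ℝ≥0∞) = t * (1 : ℝ≥0) := by simp
        _ ≤ t * (2 * (κ * J) : ℝ≥0) := by gcongr
        _ = 2 * (t * (κ * J)) := by push_cast; ring
        _ ≤ _ := by gcongr
  · set S : Set (Rn n) := {x | p x = 1} ∩ {x | 2⁻¹ < (v x : ℝ≥0∞) / t} with hS
    have hSm : MeasurableSet S := hmeas1.inter (measurableSet_lt measurable_const (by fun_prop))
    have htop : {x | conjExp p x = ∞} = {x | p x = 1} := by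
      ext x; exact conjExp_eq_top_iff hp1
    have hSpos : 0 < volume S := by
      rw [pos_iff_ne_zero]
      intro h0
      have hle : essSup (fun x => (v x : ℝ≥0∞) / t) (volume.restrict {x | conjExp p x = ∞}) ≤
          2⁻¹ := by
        refine essSup_le_of_ae_le _ ?_
        rw [htop, Filter.EventuallyLE, ae_restrict_iff' hmeas1]
        filter_upwards [measure_eq_zero_iff_ae_notMem.1 h0] with x hx hx1
        by_contra! hlt
        exact hx ⟨hx1, hlt⟩
      have := hmod.trans_le (add_le_add (not_lt.1 hI) hle)
      rw [ENNReal.inv_two_add_inv_two] at this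
      exact this.false
    obtain ⟨T, hTS, hTm, hT0, hTtop⟩ : ∃ T ⊆ S, MeasurableSet T ∧ 0 < volume T ∧ volume T < ∞ := by
      obtain ⟨T, hTm, hTS, h0, h1⟩ := Measure.exists_subset_measure_lt_top hSm hSpos
      exact ⟨T, hTS, hTm, h0, h1⟩
    obtain ⟨m, hm⟩ : ∃ m : ℝ≥0, volume T = m := ⟨_, (ENNReal.coe_toNNReal hTtop.ne).symm⟩
    have hm0 : m ≠ 0 := by
      rintro rfl; simp [hm] at hT0
    refine ⟨T.indicator fun _ => m⁻¹, measurable_const.indicator hTm, ?_, ?_⟩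
    · have : ∀ x, ((T.indicator (fun _ => m⁻¹) x : ℝ≥0) : ℝ≥0∞) ^ p x =
          T.indicator (fun _ => ((m⁻¹ : ℝ≥0) : ℝ≥0∞)) x := by
        intro x
        by_cases hx : x ∈ T
        · have : p x = 1 := (hTS hx).1
          simp [hx, this]
        · simp [hx, ENNReal.zero_rpow_of_pos (hp0 x)]
      simp only [this]
      rw [lintegral_indicator hTm, setLIntegral_const, hm, ← ENNReal.coe_mul,
        inv_mul_cancel₀ hm0, ENNReal.coe_one]
    · have hlow : T.indicator (fun _ => ((m⁻¹ : ℝ≥0) : ℝ≥0∞) * (t / 2)) ≤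
          fun x => ((T.indicator (fun _ => m⁻¹) x : ℝ≥0) : ℝ≥0∞) * v x := by
        refine indicator_le fun x hx => ?_
        simp only [indicator_of_mem hx]
        gcongr
        have h1 : 2⁻¹ < (v x : ℝ≥0∞) / t := (hTS hx).2
        rw [ENNReal.lt_div_iff_mul_lt (Or.inl ht0) (Or.inl ENNReal.coe_ne_top)] at h1
        rw [div_eq_mul_inv, mul_comm]
        exact h1.le
      calc (t : ℝ≥0∞) = 2 * (t / 2) := (ENNReal.mul_div_cancel (by simp) (by simp)).symm
        _ = 2 * ∫⁻ x, T.indicator (fun _ => ((m⁻¹ : ℝ≥0) : ℝ≥0∞) * (t / 2)) x := by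
            rw [lintegral_indicator hTm, setLIntegral_const, hm, mul_right_comm,
              ← ENNReal.coe_mul, inv_mul_cancel₀ hm0, ENNReal.coe_one, one_mul]
        _ ≤ _ := by gcongr; exact hlow _

end Duality

section Geometry

variable {n : ℕ}

namespace Cube

lemma toSet_eq_pi (Q : Cube n) :
    Q.toSet = Set.pi univ fun i => Ico (Q.base i) (Q.base i + Q.side) := by
  ext x; simp [toSet]

lemma measurableSet_toSet (Q : Cube n) : MeasurableSet Q.toSet := by
  rw [toSet_eq_pi]
  exact MeasurableSet.univ_pi fun _ => measurableSet_Ico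

lemma volume_toSet (Q : Cube n) : volume Q.toSet = Q.vol := by
  rw [toSet_eq_pi, Real.volume_pi_Ico]
  simp [vol, ENNReal.ofReal_pow Q.side_pos.le]

lemma vol_ne_zero (Q : Cube n) : Q.vol ≠ 0 := by
  simp [vol, pow_pos Q.side_pos n]

lemma vol_ne_top (Q : Cube n) : Q.vol ≠ ∞ := ENNReal.ofReal_ne_top

lemma dist_lt_side (Q : Cube n) {x y : Rn n} (hx : x ∈ Q.toSet) (hy : y ∈ Q.toSet) :
    dist x y < Q.side := by
  refine (dist_pi_lt_iff Q.side_pos).2 fun i => ?_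
  have h1 := hx i
  have h2 := hy i
  rw [Real.dist_eq, abs_lt]
  constructor <;> linarith

lemma nonempty_interior_toSet (Q : Cube n) : (interior Q.toSet).Nonempty := by
  refine ⟨fun i => Q.base i + Q.side / 2, ?_⟩
  rw [toSet_eq_pi, interior_pi_set finite_univ]
  intro i _
  simp only [interior_Ico]
  have := Q.side_pos
  constructor <;> linarith

lemma countable_of_pairwiseDisjoint {𝒬 : Set (Cube n)}
    (h : 𝒬.PairwiseDisjoint fun Q => Q.toSet) : 𝒬.Countable :=
  (h.mono fun _ => interior_subset).countable_of_nonempty_interior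
    (fun _ _ => by rw [interior_interior]; exact nonempty_interior_toSet _)

/-- Each point of a cube lies near a subcube of any smaller side length. -/
lemma exists_subcube (Q : Cube n) {x : Rn n} (hx : x ∈ Q.toSet) {l : ℝ} (hl : 0 < l)
    (hlQ : l ≤ Q.side) :
    ∃ R : Cube n, R.side = l ∧ R.toSet ⊆ Q.toSet ∧ x ∈ R.toSet := by
  refine ⟨⟨fun i => min (x i) (Q.base i + Q.side - l), l, hl⟩, rfl, ?_, ?_⟩
  · intro z hz i
    obtain ⟨h1, h2⟩ := hz i
    have h3 := hx i
    simp only at h1 h2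
    have h4 := min_le_right (x i) (Q.base i + Q.side - l)
    have h5 : Q.base i ≤ min (x i) (Q.base i + Q.side - l) := le_min h3.1 (by linarith)
    constructor <;> linarith
  · intro i
    have h3 := hx i
    refine ⟨min_le_left _ _, ?_⟩
    simp only
    rcases min_choice (x i) (Q.base i + Q.side - l) with h | h <;> rw [h] <;> linarith

end Cube

/-- The finite measure with density `(1 + ‖x‖)^{-(n+1)}`. -/
def bracketMeasure (n : ℕ) : Measure (Rn n) :=
  volume.withDensity fun x => ENNReal.ofReal ((1 + ‖x‖) ^ (-((n : ℝ) + 1)))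

lemma bracketMeasure_univ_lt_top : bracketMeasure n univ < ∞ := by
  rw [bracketMeasure, withDensity_apply _ MeasurableSet.univ, Measure.restrict_univ]
  exact finite_integral_one_add_norm (by simp)

instance : IsFiniteMeasure (bracketMeasure n) := ⟨bracketMeasure_univ_lt_top⟩

lemma le_bracketMeasure (Q : Cube n) {x : Rn n} (hx : x ∈ Q.toSet) :
    min Q.side (1 / 2) ^ n * (2 + ‖x‖) ^ (-((n : ℝ) + 1)) ≤
      (bracketMeasure n Q.toSet).toReal := by
  have hl : 0 < min Q.side (1 / 2) := lt_min Q.side_pos (by norm_num)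
  obtain ⟨R, hR, hRQ, hxR⟩ := Q.exists_subcube hx hl (min_le_left _ _)
  rw [← ENNReal.ofReal_le_iff_le_toReal (measure_ne_top _ _)]
  refine le_trans ?_ (measure_mono hRQ)
  rw [bracketMeasure, withDensity_apply _ R.measurableSet_toSet, mul_comm,
    ENNReal.ofReal_mul (by positivity), ← hR]
  change _ * R.vol ≤ _
  rw [← R.volume_toSet, ← setLIntegral_const]
  refine setLIntegral_mono' R.measurableSet_toSet fun z hz => ENNReal.ofReal_le_ofReal ?_
  refine Real.rpow_le_rpow_of_nonpos (by positivity) ?_ (by linarith [n.cast_nonneg (α := ℝ)])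
  have h1 := R.dist_lt_side hz hxR
  have h2 := norm_sub_norm_le z x
  rw [hR, dist_eq_norm] at h1
  have h3 := min_le_right Q.side (1 / 2)
  linarith

end Geometry

section LogHolder

variable {n : ℕ} {p : Rn n → ℝ}

lemma LH.continuous_inv (hp : LH0 p) : Continuous fun x => 1 / p x := by
  obtain ⟨C, hC, h⟩ := hp
  rw [continuous_iff_continuousAt]
  intro x
  rw [ContinuousAt, tendsto_iff_dist_tendsto_zero]
  have hlim : Filter.Tendsto (fun t : ℝ => C / (-Real.log t)) (nhdsWithin 0 (Ioi 0)) (nhds 0) :=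
    Filter.Tendsto.const_div_atTop
      (Filter.tendsto_neg_atBot_atTop.comp Real.tendsto_log_nhdsGT_zero) C
  rw [Metric.tendsto_nhdsWithin_nhds] at hlim
  rw [Metric.tendsto_nhds_nhds]
  intro ε hε
  obtain ⟨δ, hδ, hd⟩ := hlim ε hε
  refine ⟨min δ (1 / 2), lt_min hδ (by norm_num), fun {y} hy => ?_⟩
  rw [Real.dist_eq, sub_zero, abs_of_nonneg dist_nonneg]
  rcases eq_or_ne y x with rfl | hyx
  · simpa using hε
  rw [Real.dist_eq]
  have hpos : 0 < dist y x := dist_pos.2 hyx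
  refine (h y x (hy.trans_le (min_le_right _ _))).trans_lt ?_
  have := hd (x := dist y x) hpos (by simpa [abs_of_pos hpos] using hy.trans_le (min_le_left _ _))
  rw [Real.dist_eq, sub_zero] at this
  exact (le_abs_self _).trans_lt this

lemma LH.exists_le (hp : LH p) (hp1 : ∀ x, 1 ≤ p x) : ∃ P : ℝ, 1 ≤ P ∧ ∀ x, p x ≤ P := by
  obtain ⟨hp0, pinf, hpinf, C, hC, h⟩ := hp
  have hcont := LH.continuous_inv hp0
  have hlim : Filter.Tendsto (fun t : ℝ => C / Real.log (Real.exp 1 + t)) Filter.atTop (nhds 0) :=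
    Filter.Tendsto.const_div_atTop (Real.tendsto_log_atTop.comp
      (Filter.tendsto_atTop_add_const_left _ _ Filter.tendsto_id)) C
  have hev := hlim.eventually (gt_mem_nhds (show 0 < 1 / pinf / 2 by positivity))
  obtain ⟨R, hR⟩ := Filter.eventually_atTop.1 hev
  have hne : (Metric.closedBall (0 : Rn n) (max R 0)).Nonempty := ⟨0, by simp⟩
  obtain ⟨x₀, -, hx₀⟩ := (isCompact_closedBall (0 : Rn n) (max R 0)).exists_isMinOn hne
    hcont.continuousOn
  refine ⟨max (p x₀) (2 * pinf), (hp1 x₀).trans (le_max_left _ _), fun x => ?_⟩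
  have hpx : 0 < p x := one_pos.trans_le (hp1 x)
  have hpx₀ : 0 < p x₀ := one_pos.trans_le (hp1 x₀)
  by_cases hx : ‖x‖ ≤ max R 0
  · have : 1 / p x₀ ≤ 1 / p x := hx₀ (by simpa using hx)
    exact ((one_div_le_one_div hpx₀ hpx).1 this).trans (le_max_left _ _)
  · have h1 := hR ‖x‖ ((le_max_left _ _).trans (not_le.1 hx).le)
    have h2 := (abs_le.1 (h x)).1
    have h3 : 1 / (2 * pinf) ≤ 1 / p x := by
      have : 1 / (2 * pinf) = 1 / pinf - 1 / pinf / 2 := by field_simp; norm_num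
      rw [this]; linarith
    exact ((one_div_le_one_div (by positivity) hpx).1 h3).trans (le_max_right _ _)

/-- On a cube `Q`, the oscillation of `1 / p` is controlled by the logarithm of the
`bracketMeasure` of `Q`. -/
lemma LH.exists_osc_mul_log_le (hp : LH p) (hp1 : ∀ x, 1 ≤ p x) :
    ∃ B : ℝ, 0 ≤ B ∧ ∀ (Q : Cube n), ∀ x ∈ Q.toSet, ∀ y ∈ Q.toSet,
      |1 / p x - 1 / p y| * -Real.log (bracketMeasure n Q.toSet).toReal ≤ B := by
  obtain ⟨⟨C₀, hC₀, h0⟩, pinf, hpinf, C, hC, h⟩ := hp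
  have hinf : ∀ x y : Rn n, ‖x‖ ≤ ‖y‖ →
      |1 / p x - 1 / p y| * Real.log (Real.exp 1 + ‖x‖) ≤ 2 * C := by
    intro x y hxy
    have hlog : 0 < Real.log (Real.exp 1 + ‖x‖) :=
      Real.log_pos (by linarith [Real.add_one_lt_exp one_ne_zero, norm_nonneg x])
    have hy : C / Real.log (Real.exp 1 + ‖y‖) ≤ C / Real.log (Real.exp 1 + ‖x‖) := by gcongr
    have : |1 / p x - 1 / p y| ≤ 2 * C / Real.log (Real.exp 1 + ‖x‖) := by
      calc |1 / p x - 1 / p y| ≤ |1 / p x - 1 / pinf| + |1 / p y - 1 / pinf| := by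
            rw [abs_sub_comm (1 / p y)]; exact abs_sub_le _ _ _
        _ ≤ C / Real.log (Real.exp 1 + ‖x‖) + C / Real.log (Real.exp 1 + ‖x‖) :=
            add_le_add (h x) ((h y).trans hy)
        _ = _ := by ring
    rwa [le_div_iff₀ hlog] at this
  have hosc : ∀ x y, |1 / p x - 1 / p y| ≤ 1 := by
    intro x y
    have hx : 0 < 1 / p x ∧ 1 / p x ≤ 1 :=
      ⟨by have := hp1 x; positivity, by rw [div_le_one (by linarith [hp1 x])]; exact hp1 x⟩
    have hy : 0 < 1 / p y ∧ 1 / p y ≤ 1 :=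
      ⟨by have := hp1 y; positivity, by rw [div_le_one (by linarith [hp1 y])]; exact hp1 y⟩
    rw [abs_le]; constructor <;> linarith
  have hloc : ∀ (Q : Cube n), ∀ x ∈ Q.toSet, ∀ y ∈ Q.toSet,
      |1 / p x - 1 / p y| * -Real.log (min Q.side (1 / 2)) ≤ C₀ + 1 := by
    intro Q x hx y hy
    rcases eq_or_ne x y with rfl | hxy
    · simp; linarith
    rcases le_or_gt Q.side (1 / 2) with hQ | hQ
    · rw [min_eq_left hQ]
      have hd := Q.dist_lt_side hx hy
      have hdpos := dist_pos.2 hxy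
      have hlogd : 0 < -Real.log (dist x y) :=
        neg_pos.2 (Real.log_neg hdpos (by linarith))
      have h1 := h0 x y (hd.trans_le hQ)
      rw [le_div_iff₀ hlogd] at h1
      have h2 : |1 / p x - 1 / p y| * -Real.log Q.side ≤
          |1 / p x - 1 / p y| * -Real.log (dist x y) := by
        gcongr
      linarith
    · have h3 : -Real.log (1 / 2) = Real.log 2 := by rw [one_div, Real.log_inv, neg_neg]
      rw [min_eq_right hQ.le, h3]
      have h1 := Real.log_two_lt_d9
      have h2 := Real.log_two_gt_d9
      nlinarith [hosc x y, abs_nonneg (1 / p x - 1 / p y)]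
  refine ⟨n * (C₀ + 1) + (n + 1) * (2 * C), by positivity, fun Q => ?_⟩
  have key : ∀ x ∈ Q.toSet, ∀ y ∈ Q.toSet, ‖x‖ ≤ ‖y‖ →
      |1 / p x - 1 / p y| * -Real.log (bracketMeasure n Q.toSet).toReal ≤
        n * (C₀ + 1) + (n + 1) * (2 * C) := by
    intro x hx y hy hxy
    have hl : 0 < min Q.side (1 / 2) := lt_min Q.side_pos (by norm_num)
    have hlow := Real.log_le_log (by positivity) (le_bracketMeasure Q hx)
    rw [Real.log_mul (by positivity) (by positivity), Real.log_pow,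
      Real.log_rpow (by positivity)] at hlow
    have h2 : Real.log (2 + ‖x‖) ≤ Real.log (Real.exp 1 + ‖x‖) := by
      refine Real.log_le_log (by positivity) ?_
      linarith [Real.add_one_lt_exp one_ne_zero]
    have h3 := hinf x y hxy
    have h4 := hloc Q x hx y hy
    set D := |1 / p x - 1 / p y| with hD
    have hD0 : 0 ≤ D := abs_nonneg _
    calc D * -Real.log (bracketMeasure n Q.toSet).toReal
        ≤ D * (n * -Real.log (min Q.side (1 / 2)) + (n + 1) * Real.log (2 + ‖x‖)) := by
          gcongr; linarith
      _ ≤ D * (n * -Real.log (min Q.side (1 / 2)) + (n + 1) * Real.log (Real.exp 1 + ‖x‖)) := by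
          gcongr
      _ = n * (D * -Real.log (min Q.side (1 / 2))) +
            (n + 1) * (D * Real.log (Real.exp 1 + ‖x‖)) := by ring
      _ ≤ _ := by gcongr
  intro x hx y hy
  rcases le_total ‖x‖ ‖y‖ with hxy | hxy
  · exact key x hx y hy hxy
  · rw [abs_sub_comm]; exact key y hy x hx hxy

lemma LH.exists_rpow_le (hp : LH p) (hp1 : ∀ x, 1 ≤ p x) :
    ∃ K : ℝ, 1 ≤ K ∧ ∀ (Q : Cube n), ∀ x ∈ Q.toSet, ∀ y ∈ Q.toSet, ∀ s : ℝ, s ≤ 1 →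
      (bracketMeasure n Q.toSet).toReal ≤ s → s ^ p x ≤ K * s ^ p y := by
  obtain ⟨P, hP1, hP⟩ := hp.exists_le hp1
  obtain ⟨B, hB, hosc⟩ := hp.exists_osc_mul_log_le hp1
  refine ⟨Real.exp (P ^ 2 * B), Real.one_le_exp (by positivity), fun Q x hx y hy s hs1 hs => ?_⟩
  have hμ : 0 < (bracketMeasure n Q.toSet).toReal := by
    have hl : 0 < min Q.side (1 / 2) := lt_min Q.side_pos (by norm_num)
    exact lt_of_lt_of_le (by positivity) (le_bracketMeasure Q hx)
  have hs0 : 0 < s := hμ.trans_le hs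
  have hlog := Real.log_le_log hμ hs
  have hlog1 : Real.log s ≤ 0 := Real.log_nonpos hs0.le hs1
  rw [Real.rpow_def_of_pos hs0, Real.rpow_def_of_pos hs0, ← Real.exp_add, Real.exp_le_exp]
  have hpx : 0 < p x := one_pos.trans_le (hp1 x)
  have hpy : 0 < p y := one_pos.trans_le (hp1 y)
  have h1 : |p x - p y| ≤ P ^ 2 * |1 / p x - 1 / p y| := by
    have : p x - p y = -(p x * p y) * (1 / p x - 1 / p y) := by field_simp; ring
    rw [this, abs_mul, abs_neg, abs_of_pos (mul_pos hpx hpy), pow_two]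
    gcongr
    · exact hP x
    · exact hP y
  have h2 : |p x - p y| * -Real.log s ≤ P ^ 2 * B := by
    calc |p x - p y| * -Real.log s
        ≤ P ^ 2 * |1 / p x - 1 / p y| * -Real.log (bracketMeasure n Q.toSet).toReal := by
          gcongr; linarith
      _ = P ^ 2 * (|1 / p x - 1 / p y| * -Real.log (bracketMeasure n Q.toSet).toReal) := by ring
      _ ≤ _ := by gcongr; exact hosc Q x hx y hy
  have h3 : (p y - p x) * -Real.log s ≤ |p x - p y| * -Real.log s := by
    gcongr
    · linarith
    · rw [abs_sub_comm]; exact le_abs_self _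
  linarith

/-- Localised comparison of powers: if `g / s` has modular larger than one on `Q`, then the
powers `s ^ p x`, `x ∈ Q`, are bounded by the modular of `g` on `Q` up to a summable error. -/
lemma LH.exists_rpow_le_lintegral (hp : LH p) (hp1 : ∀ x, 1 ≤ p x) :
    ∃ K : ℝ≥0∞, K ≠ ∞ ∧ ∀ (Q : Cube n) (g : Rn n → ℝ≥0∞) (s : ℝ≥0∞), s ≤ 1 →
      1 ≤ ∫⁻ y in Q.toSet, (g y / s) ^ p y → ∀ x ∈ Q.toSet,
      s ^ p x ≤ K * (∫⁻ y in Q.toSet, g y ^ p y) + bracketMeasure n Q.toSet := by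
  obtain ⟨K, hK1, hK⟩ := hp.exists_rpow_le hp1
  refine ⟨ENNReal.ofReal K, ENNReal.ofReal_ne_top, fun Q g s hs1 hg x hx => ?_⟩
  rcases lt_or_ge s (bracketMeasure n Q.toSet) with hlt | hge
  · refine le_add_left (le_trans ?_ hlt.le)
    simpa using ENNReal.rpow_le_rpow_of_exponent_ge hs1 (hp1 x)
  refine le_add_right ?_
  rcases eq_or_ne s 0 with rfl | hs0
  · rw [ENNReal.zero_rpow_of_pos (one_pos.trans_le (hp1 x))]; exact zero_le
  have hst : s ≠ ∞ := ne_top_of_le_ne_top ENNReal.one_ne_top hs1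
  have key : ∀ y ∈ Q.toSet, s ^ p x ≤ ENNReal.ofReal K * s ^ p y := by
    intro y hy
    have h1 : s.toReal ≤ 1 := ENNReal.toReal_mono ENNReal.one_ne_top hs1
    have h2 := hK Q x hx y hy s.toReal h1 (ENNReal.toReal_mono hst hge)
    have hpos : 0 < s.toReal := ENNReal.toReal_pos hs0 hst
    rw [← ENNReal.ofReal_toReal hst, ENNReal.ofReal_rpow_of_pos hpos,
      ENNReal.ofReal_rpow_of_pos hpos, ← ENNReal.ofReal_mul (by linarith)]
    exact ENNReal.ofReal_le_ofReal h2
  calc s ^ p x = s ^ p x * 1 := (mul_one _).symm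
    _ ≤ s ^ p x * ∫⁻ y in Q.toSet, (g y / s) ^ p y := by gcongr
    _ = ∫⁻ y in Q.toSet, s ^ p x * (g y / s) ^ p y :=
        (lintegral_const_mul' _ _ (ENNReal.rpow_ne_top_of_nonneg (by linarith [hp1 x]) hst)).symm
    _ ≤ ∫⁻ y in Q.toSet, ENNReal.ofReal K * g y ^ p y := by
        refine setLIntegral_mono' Q.measurableSet_toSet fun y hy => ?_
        calc s ^ p x * (g y / s) ^ p y ≤ ENNReal.ofReal K * s ^ p y * (g y / s) ^ p y := by
              gcongr; exact key y hy
          _ = _ := by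
            rw [mul_assoc, ← ENNReal.mul_rpow_of_nonneg _ _ (by linarith [hp1 y]),
              ENNReal.mul_div_cancel hs0 hst]
    _ = _ := lintegral_const_mul' _ _ ENNReal.ofReal_ne_top

end LogHolder

section Averaging

variable {n : ℕ}

lemma IsWeight.inv {w : Rn n → ℝ} (hw : IsWeight w) : IsWeight fun x => (w x)⁻¹ :=
  ⟨hw.1.inv, hw.2.mono fun _ => inv_pos.2⟩

lemma IsWeight.mul {w₁ w₂ : Rn n → ℝ} (hw₁ : IsWeight w₁) (hw₂ : IsWeight w₂) :
    IsWeight fun x => w₁ x * w₂ x :=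
  ⟨hw₁.1.mul hw₂.1, by filter_upwards [hw₁.2, hw₂.2] with x h1 h2 using mul_pos h1 h2⟩

lemma IsWeight.vNorm_indicator_ne_zero {w : Rn n → ℝ} (hw : IsWeight w) {r : Rn n → ℝ≥0∞}
    (hr : Measurable r) (hr2 : ∀ x, 2⁻¹ ≤ r x) (Q : Cube n) :
    vNorm r (Q.toSet.indicator w) ≠ 0 := by
  intro h0
  have hm : Measurable fun x => ENNReal.ofReal |Q.toSet.indicator w x| :=
    (measurable_norm.comp (hw.1.indicator Q.measurableSet_toSet)).ennreal_ofReal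
  have h := ae_eq_zero_of_eNorm_eq_zero hr hr2 hm h0
  have hQ : ∀ᵐ x ∂volume, x ∉ Q.toSet := by
    filter_upwards [h, hw.2] with x hx hwx hxQ
    simp only [Pi.zero_apply, ENNReal.ofReal_eq_zero, indicator_of_mem hxQ] at hx
    exact hx.not_gt (abs_pos.2 hwx.ne')
  refine Q.vol_ne_zero ?_
  rw [← Q.volume_toSet]
  exact measure_eq_zero_iff_ae_notMem.2 hQ

lemma lintegral_indicator_div_rpow {p : Rn n → ℝ} (hp : ∀ x, 0 < p x) (Q : Cube n)
    (f : Rn n → ℝ≥0∞) (a : ℝ≥0∞) :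
    ∫⁻ x, (Q.toSet.indicator f x / a) ^ p x = ∫⁻ x in Q.toSet, (f x / a) ^ p x := by
  rw [← lintegral_indicator Q.measurableSet_toSet]
  refine lintegral_congr fun x => ?_
  by_cases hx : x ∈ Q.toSet
  · simp [hx]
  · simp [hx, ENNReal.zero_rpow_of_pos (hp x)]

lemma ofReal_abs_indicator (s : Set (Rn n)) (f : Rn n → ℝ) :
    (fun x => ENNReal.ofReal |s.indicator f x|) = s.indicator fun x => ENNReal.ofReal |f x| := by
  ext x
  by_cases hx : x ∈ s <;> simp [hx]

lemma eNorm_ofExp_zero {p : Rn n → ℝ} (hp : ∀ x, 0 < p x) (μ : Measure (Rn n)) :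
    eNorm (ofExp p) μ (fun _ => 0) = 0 := by
  refine le_zero_iff.1 (le_of_forall_gt fun a ha => ?_)
  obtain ⟨b, hb0, hba⟩ := exists_between ha
  refine (eNorm_le hb0.ne' ?_).trans_lt hba
  rw [eModular_ofExp fun x => (hp x).le]
  simp [ENNReal.zero_rpow_of_pos (hp _)]

lemma eNorm_ofExp_le_of_lintegral_le {p : Rn n → ℝ} (hp : ∀ x, 2⁻¹ ≤ p x)
    {f : Rn n → ℝ≥0∞} {a M : ℝ≥0∞} (ha0 : a ≠ 0) (ha : a ≠ ∞) (hM1 : 1 ≤ M) (hM : M ≠ ∞)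
    (h : ∫⁻ x, (f x / a) ^ p x ≤ M) : eNorm (ofExp p) volume f ≤ a * M ^ 2 := by
  have hM0 : M ≠ 0 := (one_pos.trans_le hM1).ne'
  have hp0 : ∀ x, 0 < p x := fun x => lt_of_lt_of_le (by norm_num) (hp x)
  refine eNorm_le (mul_ne_zero ha0 (pow_ne_zero _ hM0)) ?_
  rw [eModular_ofExp fun x => (hp0 x).le]
  have hinv : M⁻¹ ≤ 1 := ENNReal.inv_le_one.2 hM1
  calc ∫⁻ x, (f x / (a * M ^ 2)) ^ p x ≤ ∫⁻ x, M⁻¹ * (f x / a) ^ p x := by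
        refine lintegral_mono fun x => ?_
        have h1 : f x / (a * M ^ 2) = M⁻¹ ^ 2 * (f x / a) := by
          rw [div_eq_mul_inv, div_eq_mul_inv, ENNReal.mul_inv (Or.inl ha0) (Or.inl ha),
            ENNReal.inv_pow]
          ring
        simp only
        rw [h1, ENNReal.mul_rpow_of_nonneg _ _ (hp0 x).le]
        gcongr
        rw [← ENNReal.rpow_natCast, ← ENNReal.rpow_mul]
        refine ENNReal.rpow_le_self_of_le_one hinv ?_
        have := hp x
        push_cast
        linarith
    _ = M⁻¹ * ∫⁻ x, (f x / a) ^ p x := lintegral_const_mul' _ _ (by simp [hM0])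
    _ ≤ M⁻¹ * M := by gcongr
    _ = 1 := ENNReal.inv_mul_cancel hM0 hM

/-- Hölder's inequality for averages of `f`, with the weight distributed over both factors. -/
lemma setLIntegral_le_vNorm_mul {p : Rn n → ℝ} (hp : Measurable p) (hp1 : ∀ x, 1 ≤ p x)
    {f w : Rn n → ℝ} (hf : Measurable f) (hw : IsWeight w) (Q : Cube n) {a b : ℝ≥0∞}
    (ha0 : a ≠ 0) (ha : a ≠ ∞) (hb0 : b ≠ 0) (hb : b ≠ ∞)
    (hfa : vNorm (ofExp p) (Q.toSet.indicator fun x => f x * w x) < a)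
    (hwb : vNorm (conjExp p) (Q.toSet.indicator fun x => (w x)⁻¹) < b) :
    ∫⁻ x in Q.toSet, ENNReal.ofReal |f x| ≤ 2 * (a * b) := by
  have hm : Measurable fun x => ENNReal.ofReal |Q.toSet.indicator (fun x => f x * w x) x| :=
    (measurable_norm.comp ((hf.mul hw.1).indicator Q.measurableSet_toSet)).ennreal_ofReal
  refine le_trans ?_ (lintegral_mul_le_of_eModular_le_one hp hp1 hm ha0 ha hb0 hb
    (eModular_le_one_of_eNorm_lt hfa) (eModular_le_one_of_eNorm_lt hwb))
  rw [← lintegral_indicator Q.measurableSet_toSet]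
  refine lintegral_mono_ae ?_
  filter_upwards [hw.2] with x hx
  by_cases hxQ : x ∈ Q.toSet
  · simp only [indicator_of_mem hxQ]
    rw [← ENNReal.ofReal_mul (abs_nonneg _), ← abs_mul, mul_assoc, mul_inv_cancel₀ hx.ne',
      mul_one]
  · simp [hxQ]

lemma LH.exists_local_bound {p : Rn n → ℝ} (hp : Measurable p) (hp1 : ∀ x, 1 ≤ p x)
    (hpLH : LH p) :
    ∃ K : ℝ≥0∞, K ≠ ∞ ∧ ∀ f w : Rn n → ℝ, Measurable f → IsWeight w → ∀ a : ℝ≥0∞, a ≠ ∞ →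
      vNorm (ofExp p) (fun x => f x * w x) < a → ∀ Q : Cube n,
      vNorm (conjExp p) (Q.toSet.indicator fun x => (w x)⁻¹) ≠ ∞ →
      ∃ s : ℝ≥0∞, (∫⁻ x in Q.toSet, ENNReal.ofReal |f x|) ≤
          16 * a * s * vNorm (conjExp p) (Q.toSet.indicator fun x => (w x)⁻¹) ∧
        ∀ x ∈ Q.toSet, s ^ p x ≤ K * (∫⁻ y in Q.toSet,
          (ENNReal.ofReal |f y * w y| / a) ^ p y) + bracketMeasure n Q.toSet := by
  obtain ⟨K, hK, hloc⟩ := hpLH.exists_rpow_le_lintegral hp1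
  refine ⟨K, hK, fun f w hf hw a ha hfa Q hA => ?_⟩
  have hp0 : ∀ x, 0 < p x := fun x => one_pos.trans_le (hp1 x)
  have hA0 := hw.inv.vNorm_indicator_ne_zero (measurable_conjExp hp hp1)
    (fun x => le_trans (by simp) (one_le_conjExp hp1 x)) Q
  set A := vNorm (conjExp p) (Q.toSet.indicator fun x => (w x)⁻¹) with hAdef
  have ha0 : a ≠ 0 := (zero_le.trans_lt hfa).ne'
  have hA2 : A < 2 * A := by
    rw [two_mul]; exact ENNReal.lt_add_right hA hA0
  set b := vNorm (ofExp p) (Q.toSet.indicator fun x => f x * w x) with hb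
  have hba : b < a := by
    refine lt_of_le_of_lt (eNorm_mono fun x => ?_) hfa
    by_cases hx : x ∈ Q.toSet <;> simp [hx]
  have hbt : b ≠ ∞ := (hba.trans_le le_top).ne
  rcases eq_or_ne b 0 with hb0 | hb0
  · refine ⟨0, ?_, fun x _ => ?_⟩
    · rw [mul_zero, zero_mul, le_zero_iff]
      by_contra hne
      have hsmall : ∀ c : ℝ≥0∞, c ≠ 0 → c ≠ ∞ →
          ∫⁻ x in Q.toSet, ENNReal.ofReal |f x| ≤ 2 * (c * (2 * A)) := fun c hc0 hc =>
        setLIntegral_le_vNorm_mul hp hp1 hf hw Q hc0 hc (mul_ne_zero two_ne_zero hA0)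
          (ENNReal.mul_ne_top (by simp) hA) (by rw [← hb, hb0]; exact pos_iff_ne_zero.2 hc0) hA2
      have h4A0 : 4 * A ≠ 0 := mul_ne_zero (by norm_num) hA0
      have h4A : 4 * A ≠ ∞ := ENNReal.mul_ne_top (by simp) hA
      obtain ⟨ε, hε0, hε⟩ := exists_between (pos_iff_ne_zero.2 hne)
      have hεt : ε ≠ ∞ := hε.ne_top
      have := hsmall (ε / (4 * A)) (ENNReal.div_pos hε0.ne' h4A).ne'
        (ENNReal.div_ne_top hεt h4A0)
      refine hε.not_ge (this.trans_eq ?_)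
      calc 2 * (ε / (4 * A) * (2 * A)) = ε / (4 * A) * (4 * A) := by ring
        _ = ε := ENNReal.div_mul_cancel h4A0 h4A
    · rw [ENNReal.zero_rpow_of_pos (hp0 x)]; exact zero_le
  have h2a0 : 2 * a ≠ 0 := mul_ne_zero two_ne_zero ha0
  have h2a : 2 * a ≠ ∞ := ENNReal.mul_ne_top (by simp) ha
  refine ⟨b / (2 * a), ?_, hloc Q _ _ ?_ ?_⟩
  · have hb2 : b < 2 * b := by
      rw [two_mul]; exact ENNReal.lt_add_right hbt hb0
    refine (setLIntegral_le_vNorm_mul hp hp1 hf hw Q (mul_ne_zero two_ne_zero hb0)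
      (ENNReal.mul_ne_top (by simp) hbt) (mul_ne_zero two_ne_zero hA0)
      (ENNReal.mul_ne_top (by simp) hA) hb2 hA2).trans_eq ?_
    calc 2 * (2 * b * (2 * A)) = 8 * b * A := by ring
      _ = 8 * (2 * a * (b / (2 * a))) * A := by rw [ENNReal.mul_div_cancel h2a0 h2a]
      _ = _ := by ring
  · refine ENNReal.div_le_of_le_mul ?_
    rw [one_mul, two_mul]
    exact hba.le.trans le_self_add
  · have h1 := one_lt_eModular_of_lt_eNorm (ENNReal.half_pos hb0).ne' (ENNReal.half_lt_self hb0 hbt)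
    rw [ofReal_abs_indicator, eModular_ofExp fun x => (hp0 x).le,
      lintegral_indicator_div_rpow hp0] at h1
    refine h1.le.trans_eq (lintegral_congr fun x => ?_)
    congr 1
    have h2 : b / 2 = a * (b / (2 * a)) := by
      refine (ENNReal.mul_right_inj two_ne_zero ENNReal.ofNat_ne_top).1 ?_
      rw [ENNReal.mul_div_cancel two_ne_zero ENNReal.ofNat_ne_top, ← mul_assoc,
        ENNReal.mul_div_cancel h2a0 h2a]
    rw [h2, div_eq_mul_inv, ENNReal.mul_inv (Or.inl ha0) (Or.inl ha), ← mul_assoc,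
      ← div_eq_mul_inv, ← div_eq_mul_inv]

lemma TQ_of_mem {𝒬 : Set (Cube n)} (h𝒬 : 𝒬.PairwiseDisjoint fun Q => Q.toSet)
    (f₁ f₂ : Rn n → ℝ) {Q : Cube n} (hQ : Q ∈ 𝒬) {x : Rn n} (hx : x ∈ Q.toSet) :
    TQ 𝒬 f₁ f₂ x = Q.vol⁻¹ * (∫⁻ y in Q.toSet, ENNReal.ofReal |f₁ y|) *
      (Q.vol⁻¹ * ∫⁻ y in Q.toSet, ENNReal.ofReal |f₂ y|) := by
  rw [TQ, tsum_eq_single ⟨Q, hQ⟩, avgOp, indicator_of_mem hx]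
  rintro ⟨R, hR⟩ hne
  refine indicator_of_notMem (fun hxR => ?_) _
  refine hne (Subtype.ext (h𝒬.elim hR hQ ?_))
  exact not_disjoint_iff.2 ⟨x, hxR, hx⟩

lemma TQ_of_notMem {𝒬 : Set (Cube n)} (f₁ f₂ : Rn n → ℝ) {x : Rn n}
    (hx : x ∉ ⋃ Q : 𝒬, (Q : Cube n).toSet) : TQ 𝒬 f₁ f₂ x = 0 := by
  rw [TQ, ENNReal.tsum_eq_zero]
  intro Q
  exact indicator_of_notMem (fun h => hx (mem_iUnion.2 ⟨Q, h⟩)) _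

lemma TQ_eq_zero {𝒬 : Set (Cube n)} {f₁ f₂ : Rn n → ℝ}
    (h : (∫⁻ y, ENNReal.ofReal |f₁ y|) = 0 ∨ (∫⁻ y, ENNReal.ofReal |f₂ y|) = 0) (x : Rn n) :
    TQ 𝒬 f₁ f₂ x = 0 := by
  rw [TQ, ENNReal.tsum_eq_zero]
  intro Q
  refine indicator_apply_eq_zero.2 fun _ => ?_
  rcases h with h | h
  · simp [le_zero_iff.1 ((setLIntegral_le_lintegral (Q : Cube n).toSet _).trans h.le)]
  · simp [le_zero_iff.1 ((setLIntegral_le_lintegral (Q : Cube n).toSet _).trans h.le)]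

lemma lintegral_eq_zero_of_vNorm_eq_zero {p : Rn n → ℝ} (hp : Measurable p)
    (hp1 : ∀ x, 1 ≤ p x) {f w : Rn n → ℝ} (hf : Measurable f) (hw : IsWeight w)
    (h : vNorm (ofExp p) (fun x => f x * w x) = 0) : ∫⁻ y, ENNReal.ofReal |f y| = 0 := by
  have h0 := ae_eq_zero_of_eNorm_eq_zero (r := ofExp p) (by unfold ofExp; fun_prop)
    (fun x => le_trans (by simp) (ENNReal.one_le_ofReal.2 (hp1 x)))
    (measurable_norm.comp (hf.mul hw.1)).ennreal_ofReal h
  have hfm : Measurable fun y => ENNReal.ofReal |f y| :=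
    (measurable_norm.comp hf).ennreal_ofReal
  rw [lintegral_eq_zero_iff hfm]
  filter_upwards [h0, hw.2] with x hx hwx
  simp only [Pi.zero_apply, ENNReal.ofReal_eq_zero, abs_nonpos_iff, Function.comp_apply,
    Pi.mul_apply, Real.norm_eq_abs, mul_eq_zero] at hx ⊢
  exact hx.resolve_right hwx.ne'

lemma mul_rpow_le_rpow_add_rpow {q q₁ q₂ : ℝ} (hq₁ : 0 < q₁) (hq₂ : 0 < q₂)
    (hq : 1 / q = 1 / q₁ + 1 / q₂) (s t : ℝ≥0∞) : (s * t) ^ q ≤ s ^ q₁ + t ^ q₂ := by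
  have hq0 : 0 < q := by
    have : 0 < 1 / q := by rw [hq]; positivity
    exact one_div_pos.1 this
  have h1 : s ^ q = (s ^ q₁) ^ (q / q₁) := by
    rw [← ENNReal.rpow_mul, mul_div_cancel₀ _ hq₁.ne']
  have h2 : t ^ q = (t ^ q₂) ^ (q / q₂) := by
    rw [← ENNReal.rpow_mul, mul_div_cancel₀ _ hq₂.ne']
  have h3 : q / q₁ + q / q₂ = 1 := by
    have : q / q₁ + q / q₂ = q * (1 / q₁ + 1 / q₂) := by ring
    rw [this, ← hq, mul_one_div_cancel hq0.ne']
  calc (s * t) ^ q = (s ^ q₁) ^ (q / q₁) * (t ^ q₂) ^ (q / q₂) := by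
        rw [ENNReal.mul_rpow_of_nonneg _ _ hq0.le, h1, h2]
    _ ≤ (s ^ q₁ + t ^ q₂) ^ (q / q₁) * (s ^ q₁ + t ^ q₂) ^ (q / q₂) := by
        gcongr
        · exact le_self_add
        · exact le_add_self
    _ = _ := by
        rw [← ENNReal.rpow_add_of_nonneg _ _ (by positivity) (by positivity), h3,
          ENNReal.rpow_one]

end Averaging

section Equivalence

variable {n : ℕ} {p₁ p₂ p w₁ w₂ w : Rn n → ℝ}

lemma tsum_setLIntegral_le {𝒬 : Set (Cube n)} (h𝒬 : 𝒬.PairwiseDisjoint fun Q => Q.toSet)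
    (μ : Measure (Rn n)) (f : Rn n → ℝ≥0∞) :
    ∑' Q : 𝒬, ∫⁻ x in (Q : Cube n).toSet, f x ∂μ ≤ ∫⁻ x, f x ∂μ := by
  have := (Cube.countable_of_pairwiseDisjoint h𝒬).to_subtype
  rw [← lintegral_iUnion (fun Q : 𝒬 => (Q : Cube n).measurableSet_toSet)
    (fun Q R hQR => h𝒬 Q.2 R.2 (Subtype.coe_ne_coe.2 hQR))]
  exact setLIntegral_le_lintegral _ _

/-- Exponents and weights satisfying the standing assumptions of the bilinear theory. -/
structure BilinearData (p₁ p₂ p w₁ w₂ w : Rn n → ℝ) : Prop where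
  meas₁ : Measurable p₁
  meas₂ : Measurable p₂
  one_le₁ : ∀ x, 1 ≤ p₁ x
  one_le₂ : ∀ x, 1 ≤ p₂ x
  exp_eq : ∀ x, 1 / p x = 1 / p₁ x + 1 / p₂ x
  weight₁ : IsWeight w₁
  weight₂ : IsWeight w₂
  weight_eq : ∀ x, w x = w₁ x * w₂ x

namespace BilinearData

lemma half_le (D : BilinearData p₁ p₂ p w₁ w₂ w) (x : Rn n) : 2⁻¹ ≤ p x := by
  have h1 := D.one_le₁ x
  have h2 := D.one_le₂ x
  have h3 : 1 / p₁ x ≤ 1 := by rw [div_le_one (by linarith)]; exact h1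
  have h4 : 1 / p₂ x ≤ 1 := by rw [div_le_one (by linarith)]; exact h2
  have h5 : 0 < 1 / p x := by
    rw [D.exp_eq x]
    have : 0 < p₁ x := by linarith
    have : 0 < p₂ x := by linarith
    positivity
  have h6 : 1 / p x ≤ 2 := by rw [D.exp_eq x]; linarith
  rw [inv_le_comm₀ two_pos (one_div_pos.1 h5)]
  simpa using h6

lemma pos (D : BilinearData p₁ p₂ p w₁ w₂ w) (x : Rn n) : 0 < p x :=
  lt_of_lt_of_le (by norm_num) (D.half_le x)

lemma measurable (D : BilinearData p₁ p₂ p w₁ w₂ w) : Measurable p := by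
  have : p = fun x => (1 / p₁ x + 1 / p₂ x)⁻¹ := by
    ext x
    rw [← D.exp_eq x, one_div, inv_inv]
  have h1 := D.meas₁
  have h2 := D.meas₂
  rw [this]
  fun_prop

lemma weight (D : BilinearData p₁ p₂ p w₁ w₂ w) : IsWeight w :=
  funext D.weight_eq ▸ D.weight₁.mul D.weight₂

lemma vNorm_weight_ne_zero (D : BilinearData p₁ p₂ p w₁ w₂ w) (Q : Cube n) :
    vNorm (ofExp p) (Q.toSet.indicator w) ≠ 0 := by
  refine D.weight.vNorm_indicator_ne_zero ?_ (fun x => ?_) Q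
  · have := D.measurable
    unfold ofExp
    fun_prop
  · have := ENNReal.ofReal_le_ofReal (D.half_le x)
    rwa [ENNReal.ofReal_inv_of_pos two_pos, ENNReal.ofReal_ofNat] at this

/-- The `A_{p⃗(·)}` condition forces the three norms it involves to be finite. -/
lemma vNorm_ne_top (D : BilinearData p₁ p₂ p w₁ w₂ w) {C : ℝ≥0∞} (hC : C ≠ ∞) {Q : Cube n}
    (h : Q.vol⁻¹ ^ 2 * vNorm (ofExp p) (Q.toSet.indicator w) *
      vNorm (conjExp p₁) (Q.toSet.indicator fun x => (w₁ x)⁻¹) *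
      vNorm (conjExp p₂) (Q.toSet.indicator fun x => (w₂ x)⁻¹) ≤ C) :
    vNorm (ofExp p) (Q.toSet.indicator w) ≠ ∞ ∧
    vNorm (conjExp p₁) (Q.toSet.indicator fun x => (w₁ x)⁻¹) ≠ ∞ ∧
    vNorm (conjExp p₂) (Q.toSet.indicator fun x => (w₂ x)⁻¹) ≠ ∞ := by
  have h0 := D.vNorm_weight_ne_zero Q
  have h1 := D.weight₁.inv.vNorm_indicator_ne_zero (measurable_conjExp D.meas₁ D.one_le₁)
    (fun x => le_trans (by simp) (one_le_conjExp D.one_le₁ x)) Q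
  have h2 := D.weight₂.inv.vNorm_indicator_ne_zero (measurable_conjExp D.meas₂ D.one_le₂)
    (fun x => le_trans (by simp) (one_le_conjExp D.one_le₂ x)) Q
  have hv : Q.vol⁻¹ ^ 2 ≠ 0 := pow_ne_zero _ (ENNReal.inv_ne_zero.2 Q.vol_ne_top)
  have ht := ne_top_of_le_ne_top hC h
  refine ⟨fun h' => ht ?_, fun h' => ht ?_, fun h' => ht ?_⟩
  · rw [h', ENNReal.mul_top hv, ENNReal.top_mul h1, ENNReal.top_mul h2]
  · rw [h', ENNReal.mul_top (mul_ne_zero hv h0), ENNReal.top_mul h2]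
  · rw [h', ENNReal.mul_top (mul_ne_zero (mul_ne_zero hv h0) h1)]

lemma bounded_of_apVec (D : BilinearData p₁ p₂ p w₁ w₂ w) (hp₁LH : LH p₁) (hp₂LH : LH p₂)
    (h : ApVec p₁ p₂ p w₁ w₂ w) :
    ∃ C : ℝ≥0∞, C ≠ ∞ ∧ ∀ 𝒬 : Set (Cube n),
      𝒬.PairwiseDisjoint (fun Q => Q.toSet) →
      ∀ f₁ f₂ : Rn n → ℝ, Measurable f₁ → Measurable f₂ →
      eNorm (ofExp p) volume (fun x => TQ 𝒬 f₁ f₂ x * ENNReal.ofReal (w x)) ≤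
        C * vNorm (ofExp p₁) (fun x => f₁ x * w₁ x) *
          vNorm (ofExp p₂) (fun x => f₂ x * w₂ x) := by
  obtain ⟨C, hC, hA⟩ := h
  obtain ⟨K₁, hK₁, hloc₁⟩ := hp₁LH.exists_local_bound D.meas₁ D.one_le₁
  obtain ⟨K₂, hK₂, hloc₂⟩ := hp₂LH.exists_local_bound D.meas₂ D.one_le₂
  set S := bracketMeasure n univ with hS
  set M : ℝ≥0∞ := 1 + (K₁ + S + (K₂ + S)) with hMdef
  have hS_top : S ≠ ∞ := measure_ne_top _ _
  have hM : M ≠ ∞ := by finiteness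
  have hM1 : 1 ≤ M := le_self_add
  have hM0 : M ≠ 0 := (one_pos.trans_le hM1).ne'
  refine ⟨2048 * (C + 1) * M ^ 2, by finiteness, fun 𝒬 h𝒬 f₁ f₂ hf₁ hf₂ => ?_⟩
  have hC0 : 2048 * (C + 1) * M ^ 2 ≠ 0 :=
    mul_ne_zero (mul_ne_zero (by norm_num) (by simp)) (pow_ne_zero _ hM0)
  set F₁ := vNorm (ofExp p₁) (fun x => f₁ x * w₁ x) with hF₁
  set F₂ := vNorm (ofExp p₂) (fun x => f₂ x * w₂ x) with hF₂
  have htriv : F₁ = 0 ∨ F₂ = 0 →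
      eNorm (ofExp p) volume (fun x => TQ 𝒬 f₁ f₂ x * ENNReal.ofReal (w x)) ≤
        2048 * (C + 1) * M ^ 2 * F₁ * F₂ := by
    intro h0
    have : ∀ x, TQ 𝒬 f₁ f₂ x = 0 := TQ_eq_zero <| h0.imp
      (lintegral_eq_zero_of_vNorm_eq_zero D.meas₁ D.one_le₁ hf₁ D.weight₁)
      (lintegral_eq_zero_of_vNorm_eq_zero D.meas₂ D.one_le₂ hf₂ D.weight₂)
    simp only [this, zero_mul, eNorm_ofExp_zero D.pos]
    exact zero_le
  rcases eq_or_ne F₁ 0 with h10 | h10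
  · exact htriv (Or.inl h10)
  rcases eq_or_ne F₂ 0 with h20 | h20
  · exact htriv (Or.inr h20)
  rcases eq_or_ne F₁ ∞ with h1t | h1t
  · rw [h1t, ENNReal.mul_top hC0, ENNReal.top_mul h20]; exact le_top
  rcases eq_or_ne F₂ ∞ with h2t | h2t
  · rw [h2t, ENNReal.mul_top (mul_ne_zero hC0 h10)]; exact le_top
  clear htriv
  have hF₁2 : F₁ < 2 * F₁ := by rw [two_mul]; exact ENNReal.lt_add_right h1t h10
  have hF₂2 : F₂ < 2 * F₂ := by rw [two_mul]; exact ENNReal.lt_add_right h2t h20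
  have h2F₁ : 2 * F₁ ≠ ∞ := by finiteness
  have h2F₂ : 2 * F₂ ≠ ∞ := by finiteness
  set a : ℝ≥0∞ := 2048 * (C + 1) * F₁ * F₂ with ha
  have ha0 : a ≠ 0 := mul_ne_zero (mul_ne_zero (mul_ne_zero (by norm_num) (by simp)) h10) h20
  have ha_top : a ≠ ∞ := by finiteness
  set g₁ : Rn n → ℝ≥0∞ := fun y => (ENNReal.ofReal |f₁ y * w₁ y| / (2 * F₁)) ^ p₁ y with hg₁
  set g₂ : Rn n → ℝ≥0∞ := fun y => (ENNReal.ofReal |f₂ y * w₂ y| / (2 * F₂)) ^ p₂ y with hg₂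
  have hg₁1 : ∫⁻ y, g₁ y ≤ 1 := by
    have := eModular_le_one_of_eNorm_lt hF₁2
    rwa [eModular_ofExp fun x => zero_le_one.trans (D.one_le₁ x)] at this
  have hg₂1 : ∫⁻ y, g₂ y ≤ 1 := by
    have := eModular_le_one_of_eNorm_lt hF₂2
    rwa [eModular_ofExp fun x => zero_le_one.trans (D.one_le₂ x)] at this
  set H : Rn n → ℝ≥0∞ := fun x => (TQ 𝒬 f₁ f₂ x * ENNReal.ofReal (w x) / a) ^ p x with hH
  have hcube : ∀ Q ∈ 𝒬, ∫⁻ x in Q.toSet, H x ≤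
      (K₁ * (∫⁻ y in Q.toSet, g₁ y) + bracketMeasure n Q.toSet) +
        (K₂ * (∫⁻ y in Q.toSet, g₂ y) + bracketMeasure n Q.toSet) := by
    intro Q hQ
    obtain ⟨hW, hA₁, hA₂⟩ := D.vNorm_ne_top hC (hA Q)
    have hW0 := D.vNorm_weight_ne_zero Q
    obtain ⟨s₁, hs₁, he₁⟩ := hloc₁ f₁ w₁ hf₁ D.weight₁ _ h2F₁ hF₁2 Q hA₁
    obtain ⟨s₂, hs₂, he₂⟩ := hloc₂ f₂ w₂ hf₂ D.weight₂ _ h2F₂ hF₂2 Q hA₂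
    have hAQ := hA Q
    set W := vNorm (ofExp p) (Q.toSet.indicator w) with hWdef
    set A₁ := vNorm (conjExp p₁) (Q.toSet.indicator fun x => (w₁ x)⁻¹)
    set A₂ := vNorm (conjExp p₂) (Q.toSet.indicator fun x => (w₂ x)⁻¹)
    have hW2 : W < 2 * W := by rw [two_mul]; exact ENNReal.lt_add_right hW hW0
    have hwW : ∫⁻ x in Q.toSet, (ENNReal.ofReal |w x| / (2 * W)) ^ p x ≤ 1 := by
      have := eModular_le_one_of_eNorm_lt hW2
      rwa [ofReal_abs_indicator, eModular_ofExp fun x => (D.pos x).le,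
        lintegral_indicator_div_rpow D.pos] at this
    have hApW : Q.vol⁻¹ ^ 2 * A₁ * A₂ ≤ (C + 1) / W := by
      rw [ENNReal.le_div_iff_mul_le (Or.inl hW0) (Or.inl hW)]
      calc Q.vol⁻¹ ^ 2 * A₁ * A₂ * W = Q.vol⁻¹ ^ 2 * W * A₁ * A₂ := by ring
        _ ≤ C := hAQ
        _ ≤ C + 1 := le_self_add
    have hpt : ∀ x ∈ Q.toSet, TQ 𝒬 f₁ f₂ x * ENNReal.ofReal (w x) / a ≤
        s₁ * s₂ * (ENNReal.ofReal |w x| / (2 * W)) := by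
      intro x hx
      rw [TQ_of_mem h𝒬 f₁ f₂ hQ hx]
      refine ENNReal.div_le_of_le_mul ?_
      have hw_abs : ENNReal.ofReal (w x) ≤ ENNReal.ofReal |w x| :=
        ENNReal.ofReal_le_ofReal (le_abs_self _)
      calc Q.vol⁻¹ * (∫⁻ y in Q.toSet, ENNReal.ofReal |f₁ y|) *
            (Q.vol⁻¹ * ∫⁻ y in Q.toSet, ENNReal.ofReal |f₂ y|) * ENNReal.ofReal (w x)
          ≤ Q.vol⁻¹ * (16 * (2 * F₁) * s₁ * A₁) * (Q.vol⁻¹ * (16 * (2 * F₂) * s₂ * A₂)) *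
              ENNReal.ofReal |w x| := by gcongr
        _ = 1024 * F₁ * F₂ * (s₁ * s₂) * (Q.vol⁻¹ ^ 2 * A₁ * A₂) * ENNReal.ofReal |w x| := by
            ring
        _ ≤ 1024 * F₁ * F₂ * (s₁ * s₂) * ((C + 1) / W) * ENNReal.ofReal |w x| := by gcongr
        _ = 1024 * F₁ * F₂ * (s₁ * s₂) * ((C + 1) * (2 * (2⁻¹ * W⁻¹))) *
              ENNReal.ofReal |w x| := by
            rw [← mul_assoc 2, ENNReal.mul_inv_cancel two_ne_zero ENNReal.ofNat_ne_top, one_mul,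
              ← div_eq_mul_inv]
        _ = s₁ * s₂ * (ENNReal.ofReal |w x| * (2⁻¹ * W⁻¹)) * a := by rw [ha]; ring
        _ = s₁ * s₂ * (ENNReal.ofReal |w x| / (2 * W)) * a := by
            rw [div_eq_mul_inv _ (2 * W), ENNReal.mul_inv (Or.inl two_ne_zero)
              (Or.inl ENNReal.ofNat_ne_top)]
    set E := (K₁ * (∫⁻ y in Q.toSet, g₁ y) + bracketMeasure n Q.toSet) +
        (K₂ * (∫⁻ y in Q.toSet, g₂ y) + bracketMeasure n Q.toSet) with hE
    have hEt : E ≠ ∞ := by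
      have h1 : ∫⁻ y in Q.toSet, g₁ y ≠ ∞ := ne_top_of_le_ne_top ENNReal.one_ne_top
        ((setLIntegral_le_lintegral _ _).trans hg₁1)
      have h2 : ∫⁻ y in Q.toSet, g₂ y ≠ ∞ := ne_top_of_le_ne_top ENNReal.one_ne_top
        ((setLIntegral_le_lintegral _ _).trans hg₂1)
      have h3 : bracketMeasure n Q.toSet ≠ ∞ := measure_ne_top _ _
      finiteness
    calc ∫⁻ x in Q.toSet, H x
        ≤ ∫⁻ x in Q.toSet, E * (ENNReal.ofReal |w x| / (2 * W)) ^ p x := by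
          refine setLIntegral_mono' Q.measurableSet_toSet fun x hx => ?_
          calc H x ≤ (s₁ * s₂ * (ENNReal.ofReal |w x| / (2 * W))) ^ p x :=
                ENNReal.rpow_le_rpow (hpt x hx) (D.pos x).le
            _ = (s₁ * s₂) ^ p x * (ENNReal.ofReal |w x| / (2 * W)) ^ p x :=
                ENNReal.mul_rpow_of_nonneg _ _ (D.pos x).le
            _ ≤ E * (ENNReal.ofReal |w x| / (2 * W)) ^ p x := by
                gcongr
                exact (mul_rpow_le_rpow_add_rpow (one_pos.trans_le (D.one_le₁ x))
                  (one_pos.trans_le (D.one_le₂ x)) (D.exp_eq x) _ _).trans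
                  (add_le_add (he₁ x hx) (he₂ x hx))
      _ = E * ∫⁻ x in Q.toSet, (ENNReal.ofReal |w x| / (2 * W)) ^ p x :=
          lintegral_const_mul' _ _ hEt
      _ ≤ E := mul_le_of_le_one_right' hwW
  have htot : ∫⁻ x, H x ≤ M := by
    have := (Cube.countable_of_pairwiseDisjoint h𝒬).to_subtype
    have hUm : MeasurableSet (⋃ Q : 𝒬, (Q : Cube n).toSet) :=
      MeasurableSet.iUnion fun Q => (Q : Cube n).measurableSet_toSet
    have hdisj : Pairwise fun Q R : 𝒬 => Disjoint (Q : Cube n).toSet (R : Cube n).toSet :=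
      fun Q R hQR => h𝒬 Q.2 R.2 (Subtype.coe_ne_coe.2 hQR)
    have hHU : H = (⋃ Q : 𝒬, (Q : Cube n).toSet).indicator H := by
      refine (indicator_eq_self.2 fun x hx => ?_).symm
      by_contra hxU
      refine hx ?_
      simp only [hH, TQ_of_notMem f₁ f₂ hxU, zero_mul, ENNReal.zero_div,
        ENNReal.zero_rpow_of_pos (D.pos x)]
    have hμ : ∑' Q : 𝒬, bracketMeasure n (Q : Cube n).toSet ≤ S := by
      simpa using tsum_setLIntegral_le h𝒬 (bracketMeasure n) (fun _ => 1)
    rw [hHU, lintegral_indicator hUm, lintegral_iUnion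
      (fun Q : 𝒬 => (Q : Cube n).measurableSet_toSet) hdisj]
    calc ∑' Q : 𝒬, ∫⁻ x in (Q : Cube n).toSet, H x
        ≤ ∑' Q : 𝒬, ((K₁ * (∫⁻ y in (Q : Cube n).toSet, g₁ y) +
            bracketMeasure n (Q : Cube n).toSet) +
          (K₂ * (∫⁻ y in (Q : Cube n).toSet, g₂ y) + bracketMeasure n (Q : Cube n).toSet)) :=
          ENNReal.tsum_le_tsum fun Q => hcube Q Q.2
      _ = (K₁ * ∑' Q : 𝒬, (∫⁻ y in (Q : Cube n).toSet, g₁ y)) +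
            ∑' Q : 𝒬, bracketMeasure n (Q : Cube n).toSet +
          ((K₂ * ∑' Q : 𝒬, ∫⁻ y in (Q : Cube n).toSet, g₂ y) +
            ∑' Q : 𝒬, bracketMeasure n (Q : Cube n).toSet) := by
          rw [ENNReal.tsum_add, ENNReal.tsum_add, ENNReal.tsum_add, ENNReal.tsum_mul_left,
            ENNReal.tsum_mul_left]
      _ ≤ K₁ * 1 + S + (K₂ * 1 + S) := by
          gcongr
          · exact (tsum_setLIntegral_le h𝒬 _ _).trans hg₁1
          · exact (tsum_setLIntegral_le h𝒬 _ _).trans hg₂1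
      _ ≤ M := by rw [mul_one, mul_one]; exact le_add_self
  calc eNorm (ofExp p) volume (fun x => TQ 𝒬 f₁ f₂ x * ENNReal.ofReal (w x))
      ≤ a * M ^ 2 := eNorm_ofExp_le_of_lintegral_le D.half_le ha0 ha_top hM1 hM htot
    _ = _ := by rw [ha]; ring

/-- Test functions on a cube that almost realise the conjugate norm of the inverse weight. -/
lemma exists_test_function {q v : Rn n → ℝ} (hq : Measurable q) (hq1 : ∀ x, 1 ≤ q x)
    (hv : IsWeight v) (Q : Cube n) {t : ℝ≥0∞}
    (ht : t < vNorm (conjExp q) (Q.toSet.indicator fun x => (v x)⁻¹)) :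
    ∃ f : Rn n → ℝ, Measurable f ∧ vNorm (ofExp q) (fun x => f x * v x) ≤ 1 ∧
      t ≤ 2 * ∫⁻ x in Q.toSet, ENNReal.ofReal |f x| := by
  have hm : Measurable (Q.toSet.indicator fun x => (v x)⁻¹) :=
    hv.inv.1.indicator Q.measurableSet_toSet
  obtain ⟨h, hh, hh1, hht⟩ := exists_dual_of_lt_eNorm hq hq1
    (v := fun x => Real.toNNReal |Q.toSet.indicator (fun x => (v x)⁻¹) x|)
    (measurable_norm.comp hm).real_toNNReal ht
  refine ⟨fun x => h x * |Q.toSet.indicator (fun x => (v x)⁻¹) x|,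
    hh.coe_nnreal_real.mul (measurable_norm.comp hm), ?_, hht.trans_eq ?_⟩
  · refine eNorm_le one_ne_zero ?_
    rw [eModular_ofExp fun x => zero_le_one.trans (hq1 x)]
    refine (lintegral_mono fun x => ?_).trans hh1
    refine ENNReal.rpow_le_rpow ?_ (zero_le_one.trans (hq1 x))
    rw [div_one, ← ENNReal.ofReal_coe_nnreal]
    refine ENNReal.ofReal_le_ofReal ?_
    beta_reduce
    rw [mul_assoc, abs_mul, NNReal.abs_eq]
    refine mul_le_of_le_one_right NNReal.zero_le_coe ?_
    rw [abs_mul, abs_abs, ← abs_mul]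
    by_cases hx : x ∈ Q.toSet
    · rw [indicator_of_mem hx]
      rcases eq_or_ne (v x) 0 with h0 | h0
      · simp [h0]
      · simp [inv_mul_cancel₀ h0]
    · simp [hx]
  · rw [← lintegral_indicator Q.measurableSet_toSet]
    congr 1
    refine lintegral_congr fun x => ?_
    by_cases hx : x ∈ Q.toSet
    · simp only [indicator_of_mem hx, abs_mul, abs_abs, NNReal.abs_eq]
      rw [ENNReal.ofReal_mul NNReal.zero_le_coe, ENNReal.ofReal_coe_nnreal]
      rfl
    · simp [hx]

lemma apVec_of_bounded (D : BilinearData p₁ p₂ p w₁ w₂ w) {C : ℝ≥0∞} (hC : C ≠ ∞)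
    (h : ∀ (Q : Cube n) (f₁ f₂ : Rn n → ℝ), Measurable f₁ → Measurable f₂ →
      eNorm (ofExp p) volume (fun x => TQ {Q} f₁ f₂ x * ENNReal.ofReal (w x)) ≤
        C * vNorm (ofExp p₁) (fun x => f₁ x * w₁ x) *
          vNorm (ofExp p₂) (fun x => f₂ x * w₂ x)) :
    ApVec p₁ p₂ p w₁ w₂ w := by
  refine ⟨4 * C, by finiteness, fun Q => ?_⟩
  have hmul : ∀ {A X B : ℝ≥0∞}, (∀ t < A, t * X ≤ B) → A * X ≤ B := fun {A X B} hAX =>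
    ENNReal.mul_le_of_forall_lt fun t ht b hb =>
      (mul_le_mul_right hb.le t).trans (hAX t ht)
  set W := vNorm (ofExp p) (Q.toSet.indicator w) with hW
  rw [mul_right_comm, mul_comm _ (vNorm (conjExp p₁) _)]
  refine hmul fun t₁ ht₁ => ?_
  rw [mul_left_comm, mul_comm _ (vNorm (conjExp p₂) _), mul_left_comm]
  refine hmul fun t₂ ht₂ => ?_
  obtain ⟨f₁, hf₁, hn₁, hi₁⟩ := exists_test_function D.meas₁ D.one_le₁ D.weight₁ Q ht₁
  obtain ⟨f₂, hf₂, hn₂, hi₂⟩ := exists_test_function D.meas₂ D.one_le₂ D.weight₂ Q ht₂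
  set I₁ := ∫⁻ x in Q.toSet, ENNReal.ofReal |f₁ x|
  set I₂ := ∫⁻ x in Q.toSet, ENNReal.ofReal |f₂ x|
  have hTQ : (fun x => Q.vol⁻¹ * I₁ * (Q.vol⁻¹ * I₂) * ENNReal.ofReal |Q.toSet.indicator w x|)
      =ᵐ[volume] fun x => TQ {Q} f₁ f₂ x * ENNReal.ofReal (w x) := by
    filter_upwards [D.weight.2] with x hwx
    by_cases hx : x ∈ Q.toSet
    · rw [indicator_of_mem hx, abs_of_pos hwx,
        TQ_of_mem (pairwiseDisjoint_singleton _ _) f₁ f₂ (mem_singleton Q) hx]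
    · rw [indicator_of_notMem hx, TQ_of_notMem f₁ f₂ (by simpa using hx)]
      simp
  have hW' : Q.vol⁻¹ * I₁ * (Q.vol⁻¹ * I₂) * W ≤ C :=
    calc Q.vol⁻¹ * I₁ * (Q.vol⁻¹ * I₂) * W
        ≤ eNorm (ofExp p) volume (fun x => TQ {Q} f₁ f₂ x * ENNReal.ofReal (w x)) :=
          (mul_eNorm_le_eNorm_const_mul _ _ _ _).trans_eq (eNorm_congr_ae hTQ)
      _ ≤ C * 1 * 1 := (h Q f₁ f₂ hf₁ hf₂).trans (by gcongr)
      _ = C := by rw [mul_one, mul_one]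
  calc t₂ * (Q.vol⁻¹ ^ 2 * W * t₁) ≤ 2 * I₂ * (Q.vol⁻¹ ^ 2 * W * (2 * I₁)) := by gcongr
    _ = 4 * (Q.vol⁻¹ * I₁ * (Q.vol⁻¹ * I₂) * W) := by ring
    _ ≤ 4 * C := by gcongr

end BilinearData

end Equivalence

/-- for log-Hölder continuous exponents, `(w₁,w₂,w) ∈ A_{p⃗(·)}` iff the
operators `T_𝒬` are uniformly bounded over all disjoint families of cubes. -/
theorem statement3 {n : ℕ} (p₁ p₂ p w₁ w₂ w : Rn n → ℝ)
    (hp₁m : Measurable p₁) (hp₂m : Measurable p₂)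
    (hp₁1 : ∀ x, 1 ≤ p₁ x) (hp₂1 : ∀ x, 1 ≤ p₂ x)
    (hp₁LH : LH p₁) (hp₂LH : LH p₂)
    (hp : ∀ x, 1 / p x = 1 / p₁ x + 1 / p₂ x)
    (hw₁ : IsWeight w₁) (hw₂ : IsWeight w₂)
    (hw : ∀ x, w x = w₁ x * w₂ x) :
    ApVec p₁ p₂ p w₁ w₂ w ↔
      ∃ C : ℝ≥0∞, C ≠ ∞ ∧ ∀ 𝒬 : Set (Cube n),
        𝒬.PairwiseDisjoint (fun Q => Q.toSet) →
        ∀ f₁ f₂ : Rn n → ℝ, Measurable f₁ → Measurable f₂ →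
        eNorm (ofExp p) volume (fun x => TQ 𝒬 f₁ f₂ x * ENNReal.ofReal (w x)) ≤
          C * vNorm (ofExp p₁) (fun x => f₁ x * w₁ x) *
            vNorm (ofExp p₂) (fun x => f₂ x * w₂ x) := by
  have D : BilinearData p₁ p₂ p w₁ w₂ w := ⟨hp₁m, hp₂m, hp₁1, hp₂1, hp, hw₁, hw₂, hw⟩
  exact ⟨D.bounded_of_apVec hp₁LH hp₂LH, fun ⟨C, hC, h⟩ => D.apVec_of_bounded hC
    fun Q f₁ f₂ hf₁ hf₂ => h {Q} (pairwiseDisjoint_singleton _ _) f₁ f₂ hf₁ hf₂⟩
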